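/- arXiv:2108.06646 — 4 statements merged into one kernel-verified Lean document; each statement's English description precedes it below -/
import Mathlib

section
/- There exists an irreducible overlap-free binary word of length n if and only if n ∈ {6, 8, 9, 10} or n ≥ 12. -/
/-- An overlap is a word of the form xYxYx where x is a letter and Y is a
possibly empty word. -/
def IsOverlap {α : Type*} (w : List α) : Prop :=
  ∃ (x : α) (Y : List α), w = [x] ++ Y ++ [x] ++ Y ++ [x]

/-- A word contains an overlap if some factor (contiguous subword) of it is an overlap. -/
def HasOverlap {α : Type*} (w : List α) : Prop :=
  ∃ u, u <:+: w ∧ IsOverlap u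

/-- A word is overlap-free if none of its factors is an overlap. -/
def OverlapFree {α : Type*} (w : List α) : Prop := ¬ HasOverlap w

/-- An irreducible overlap-free word: an overlap-free word of length at least 3
such that removing any one interior letter creates an overlap. -/
def IrreducibleOverlapFree (w : List (Fin 2)) : Prop :=
  OverlapFree w ∧ 3 ≤ w.length ∧
    ∀ i : ℕ, 0 < i → i + 1 < w.length → HasOverlap (w.eraseIdx i)

theorem hasOverlap_iff {α : Type*} (w : List α) :
    HasOverlap w ↔ ∃ v ∈ w.tails, ∃ p < v.length,
      p + 2 ≤ v.length ∧ v.take (p + 2) <+: v.drop (p + 1) := by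
  simp only [List.mem_tails]
  constructor
  · rintro ⟨_, ⟨a, b, rfl⟩, x, Y, rfl⟩
    refine ⟨[x] ++ Y ++ [x] ++ Y ++ [x] ++ b, ⟨a, by simp⟩, Y.length, by simp,
      by simp, b, ?_⟩
    have h₁ : [x] ++ Y ++ [x] ++ Y ++ [x] ++ b = ([x] ++ Y ++ [x]) ++ (Y ++ [x] ++ b) := by simp
    have h₂ : [x] ++ Y ++ [x] ++ Y ++ [x] ++ b = ([x] ++ Y) ++ ([x] ++ Y ++ [x] ++ b) := by simp
    conv_rhs => rw [h₂, List.drop_left' (by simp)]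
    rw [h₁, List.take_left' (by simp)]
  · rintro ⟨v, hv, p, -, hp, s, hs⟩
    obtain ⟨x, l, rfl⟩ : ∃ x l, v = x :: l := by
      cases v with
      | nil => simp at hp
      | cons x l => exact ⟨x, l, rfl⟩
    simp only [List.take_succ_cons, List.drop_succ_cons, List.cons_append,
      List.length_cons] at hs hp
    have hx : l[p]? = some x := by
      have := congrArg (fun r => r[0]?) hs
      simpa using this.symm
    have ht : l.take (p + 1) = l.take p ++ [x] := by
      rw [List.take_add_one, hx]; rfl
    refine ⟨[x] ++ l.take p ++ [x] ++ l.take p ++ [x],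
      List.IsInfix.trans ⟨[], s, ?_⟩ hv.isInfix, x, l.take p, rfl⟩
    have h := List.take_append_drop p l
    rw [← hs, ht] at h
    conv_rhs => rw [← h]
    simp

instance {α : Type*} [DecidableEq α] : DecidablePred (HasOverlap (α := α)) :=
  fun w => decidable_of_iff _ (hasOverlap_iff w).symm

instance {α : Type*} [DecidableEq α] : DecidablePred (OverlapFree (α := α)) :=
  fun w => inferInstanceAs (Decidable (¬ HasOverlap w))

theorem HasOverlap.mono {α : Type*} {v w : List α} (hv : HasOverlap v) (h : v <:+: w) :
    HasOverlap w := by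
  obtain ⟨u, hu, hu'⟩ := hv
  exact ⟨u, hu.trans h, hu'⟩

/-- The list of overlap-free binary words of length `n`. -/
def overlapFreeWords : ℕ → List (List (Fin 2))
  | 0 => [[]]
  | n + 1 => ((overlapFreeWords n).flatMap fun w => [0 :: w, 1 :: w]).filter
      fun w => decide (OverlapFree w)

theorem OverlapFree.mem_overlapFreeWords {w : List (Fin 2)} (h : OverlapFree w) :
    w ∈ overlapFreeWords w.length := by
  induction w with
  | nil => simp [overlapFreeWords]
  | cons x w ih =>
    have hw : OverlapFree w := fun h' => h (h'.mono (List.suffix_cons x w).isInfix)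
    simp only [overlapFreeWords, List.length_cons, List.mem_filter, List.mem_flatMap]
    refine ⟨⟨w, ih hw, ?_⟩, by simpa using h⟩
    fin_cases x <;> simp

theorem irreducibleOverlapFree_iff (w : List (Fin 2)) :
    IrreducibleOverlapFree w ↔ OverlapFree w ∧ 3 ≤ w.length ∧
      ∀ i < w.length, 0 < i → i + 1 < w.length → HasOverlap (w.eraseIdx i) := by
  refine and_congr_right fun _ => and_congr_right fun _ =>
    ⟨fun h i _ => h i, fun h i h₀ h₁ => h i (by omega) h₀ h₁⟩

instance : DecidablePred IrreducibleOverlapFree :=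
  fun w => decidable_of_iff _ (irreducibleOverlapFree_iff w).symm

/-- The Thue–Morse sequence: the parity of the sum of the binary digits of `n`. -/
def thueMorse (n : ℕ) : Fin 2 :=
  if h : n = 0 then 0 else if n % 2 = 0 then thueMorse (n / 2) else thueMorse (n / 2) + 1
termination_by n

theorem thueMorse_two_mul (n : ℕ) : thueMorse (2 * n) = thueMorse n := by
  rcases Nat.eq_zero_or_pos n with rfl | hn
  · rfl
  · rw [thueMorse]
    simp [hn.ne']

theorem thueMorse_two_mul_add_one (n : ℕ) : thueMorse (2 * n + 1) = thueMorse n + 1 := by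
  rw [thueMorse]
  have h : (2 * n + 1) / 2 = n := by omega
  simp [h, Nat.add_mod]

/-- Position `n` is a change if the Thue–Morse sequence takes different values at `n` and
`n + 1`. -/
def IsChange (n : ℕ) : Prop := thueMorse n ≠ thueMorse (n + 1)

theorem fin_two_ne_iff (a b : Fin 2) : a ≠ b ↔ b = a + 1 := by
  decide +revert

theorem isChange_two_mul (n : ℕ) : IsChange (2 * n) := by
  rw [IsChange, thueMorse_two_mul, thueMorse_two_mul_add_one]
  generalize thueMorse n = a
  decide +revert

theorem isChange_two_mul_add_one (n : ℕ) : IsChange (2 * n + 1) ↔ ¬ IsChange n := by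
  rw [IsChange, IsChange, show 2 * n + 1 + 1 = 2 * (n + 1) by ring, thueMorse_two_mul,
    thueMorse_two_mul_add_one]
  generalize thueMorse n = a
  generalize thueMorse (n + 1) = b
  decide +revert

theorem thueMorse_not_overlap (p : ℕ) (hp : 0 < p) (s : ℕ) :
    ¬ ∀ j ≤ p, thueMorse (s + j) = thueMorse (s + j + p) := by
  induction p using Nat.strong_induction_on generalizing s with
  | _ p ih =>
  intro h
  obtain ⟨q, rfl | rfl⟩ := Nat.even_or_odd' p
  · refine ih q (by omega) (by omega) (s / 2) fun k hk => ?_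
    have hk' := h (2 * k) (by omega)
    obtain ⟨m, rfl | rfl⟩ := Nat.even_or_odd' s
    · rw [show 2 * m / 2 = m by omega]
      rwa [show 2 * m + 2 * k + 2 * q = 2 * (m + k + q) by ring,
        show 2 * m + 2 * k = 2 * (m + k) by ring, thueMorse_two_mul, thueMorse_two_mul] at hk'
    · rw [show (2 * m + 1) / 2 = m by omega]
      rw [show 2 * m + 1 + 2 * k + 2 * q = 2 * (m + k + q) + 1 by ring,
        show 2 * m + 1 + 2 * k = 2 * (m + k) + 1 by ring, thueMorse_two_mul_add_one,
        thueMorse_two_mul_add_one] at hk'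
      exact add_right_cancel hk'
  · have hc : ∀ j < 2 * q + 1, thueMorse (s + (j + 1)) = thueMorse (s + j) + 1 := by
      intro j hj
      rw [← fin_two_ne_iff]
      obtain ⟨m, hm | hm⟩ := Nat.even_or_odd' (s + j)
      · have := isChange_two_mul m
        rwa [← hm] at this
      · have := isChange_two_mul (m + q + 1)
        rw [IsChange, show 2 * (m + q + 1) = s + j + (2 * q + 1) by omega,
          show s + j + (2 * q + 1) + 1 = s + (j + 1) + (2 * q + 1) by ring,
          ← h j (by omega), ← h (j + 1) (by omega)] at this
        exact this
    have hj : ∀ j ≤ 2 * q + 1, thueMorse (s + j) = thueMorse s + if j % 2 = 0 then 0 else 1 := by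
      intro j
      induction j with
      | zero => simp
      | succ j ihj =>
        intro hj
        rw [hc j (by omega), ihj (by omega)]
        generalize thueMorse s = a
        rcases Nat.mod_two_eq_zero_or_one j with h0 | h0 <;>
          simp [h0, Nat.add_mod, add_assoc]
    have h₁ := hj (2 * q + 1) le_rfl
    have h₀ := h 0 (by omega)
    rw [add_zero] at h₀
    rw [← h₀] at h₁
    simp [Nat.add_mod] at h₁

/-- The factor of length `n` of the Thue–Morse sequence starting at position `i`. -/
def thueMorseFactor (i n : ℕ) : List (Fin 2) := (List.range n).map fun j => thueMorse (i + j)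

@[simp]
theorem length_thueMorseFactor (i n : ℕ) : (thueMorseFactor i n).length = n := by
  simp [thueMorseFactor]

theorem thueMorseFactor_add (i m n : ℕ) :
    thueMorseFactor i (m + n) = thueMorseFactor i m ++ thueMorseFactor (i + m) n := by
  simp [thueMorseFactor, List.range_add, add_assoc]

theorem overlapFree_thueMorseFactor (i n : ℕ) : OverlapFree (thueMorseFactor i n) := by
  rintro ⟨_, ⟨a, b, h⟩, x, Y, rfl⟩
  refine thueMorse_not_overlap (Y.length + 1) (by omega) (i + a.length) fun j hj => ?_
  have hlen := congrArg List.length h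
  simp only [List.length_append, length_thueMorseFactor, List.length_singleton] at hlen
  have h₁ : thueMorseFactor i n = a ++ (([x] ++ Y ++ [x]) ++ (Y ++ [x] ++ b)) := by
    rw [← h]; simp
  have h₂ : thueMorseFactor i n = (a ++ [x] ++ Y) ++ (([x] ++ Y ++ [x]) ++ b) := by
    rw [← h]; simp
  have e : ∀ k < n, (thueMorseFactor i n)[k]? = some (thueMorse (i + k)) := by
    intro k hk
    simp [thueMorseFactor, hk]
  have e₁ := e (a.length + j) (by omega)
  have e₂ := e ((a ++ [x] ++ Y).length + j) (by simp; omega)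
  rw [h₁, List.getElem?_append_right (by omega), Nat.add_sub_cancel_left,
    List.getElem?_append_left (by simp; omega)] at e₁
  rw [h₂, List.getElem?_append_right (by omega), Nat.add_sub_cancel_left,
    List.getElem?_append_left (by simp; omega), e₁] at e₂
  simp only [List.length_append, List.length_singleton] at e₂
  rw [Option.some_inj] at e₂
  rw [add_assoc i, e₂]
  congr 1
  ring

theorem thueMorseFactor_mem_overlapFreeWords (i n : ℕ) :
    thueMorseFactor i n ∈ overlapFreeWords n := by
  simpa using (overlapFree_thueMorseFactor i n).mem_overlapFreeWords

theorem take_thueMorseFactor_add (i m n : ℕ) :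
    (thueMorseFactor i (m + n)).take m = thueMorseFactor i m := by
  rw [thueMorseFactor_add, List.take_left' (by simp)]

theorem drop_thueMorseFactor_add (i m n : ℕ) :
    (thueMorseFactor i (m + n)).drop m = thueMorseFactor (i + m) n := by
  rw [thueMorseFactor_add, List.drop_left' (by simp)]

theorem hasOverlap_eraseIdx_seven :
    ∀ w ∈ overlapFreeWords 15, HasOverlap (w.eraseIdx 7) := by
  decide +kernel

/-- A left end of an irreducible factor: near position `i`, deleting a letter other than the
one at `i` creates an overlap. -/
def IsLeftEnd (i : ℕ) : Prop :=
  ∀ r < 7, 0 < r → HasOverlap ((thueMorseFactor i 15).eraseIdx r)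

/-- A right end of an irreducible factor: near position `i + 14`, deleting a letter other than
the one at `i + 14` creates an overlap. -/
def IsRightEnd (i : ℕ) : Prop :=
  ∀ r < 14, 7 < r → HasOverlap ((thueMorseFactor i 15).eraseIdx r)

theorem hasOverlap_eraseIdx_of_take_eq :
    ∀ w ∈ overlapFreeWords 15, ∀ a : Fin 2,
      (w.take 5 = [a, a + 1, a + 1, a, a + 1] ∨
        w.take 6 = [a, a + 1, a, a, a + 1, a] ∨
        w.take 10 = [a, a + 1, a, a + 1, a + 1, a, a, a + 1, a + 1, a] ∨
        w.take 14 = [a, a + 1, a, a, a + 1, a + 1, a, a, a + 1, a, a + 1, a + 1, a, a]) →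
      ∀ r < 7, 0 < r → HasOverlap (w.eraseIdx r) := by
  decide +kernel

theorem hasOverlap_eraseIdx_of_drop_eq :
    ∀ w ∈ overlapFreeWords 15, ∀ a : Fin 2,
      (w.drop 10 = [a, a + 1, a, a, a + 1] ∨
        w.drop 9 = [a, a + 1, a, a, a + 1, a]) →
      ∀ r < 14, 7 < r → HasOverlap (w.eraseIdx r) := by
  decide +kernel

theorem irreducibleOverlapFree_thueMorseFactor {i m : ℕ} (hl : IsLeftEnd i)
    (hr : IsRightEnd (i + m)) : IrreducibleOverlapFree (thueMorseFactor i (m + 15)) := by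
  have window : ∀ a ≤ m, ∀ r < 15, HasOverlap ((thueMorseFactor (i + a) 15).eraseIdx r) →
      HasOverlap ((thueMorseFactor i (m + 15)).eraseIdx (a + r)) := by
    intro a ha r hr h
    obtain ⟨b, rfl⟩ := Nat.exists_eq_add_of_le ha
    refine h.mono ⟨thueMorseFactor i a, thueMorseFactor (i + a + 15) b, ?_⟩
    rw [show a + b + 15 = a + (15 + b) by ring, thueMorseFactor_add i a, thueMorseFactor_add,
      List.eraseIdx_append_of_length_le (by simp), length_thueMorseFactor, Nat.add_sub_cancel_left,
      List.eraseIdx_append_of_lt_length (by simpa), List.append_assoc]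
  refine ⟨overlapFree_thueMorseFactor _ _, by simp, fun r h₀ h₁ => ?_⟩
  rw [length_thueMorseFactor] at h₁
  rcases lt_or_ge r 7 with h | h
  · simpa using window 0 (by omega) r (by omega) (hl r h h₀)
  rcases le_or_gt r (m + 7) with h' | h'
  · have := window (r - 7) (by omega) 7 (by omega)
      (hasOverlap_eraseIdx_seven _ (thueMorseFactor_mem_overlapFreeWords _ _))
    rwa [Nat.sub_add_cancel h] at this
  · have := window m le_rfl (r - m) (by omega) (hr (r - m) (by omega) (by omega))
    rwa [Nat.add_sub_cancel' (by omega)] at this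

theorem thueMorse_four_mul_add (n c : ℕ) :
    thueMorse (4 * n + 4 * c) = thueMorse (n + c) ∧
      thueMorse (4 * n + (4 * c + 1)) = thueMorse (n + c) + 1 ∧
      thueMorse (4 * n + (4 * c + 2)) = thueMorse (n + c) + 1 ∧
      thueMorse (4 * n + (4 * c + 3)) = thueMorse (n + c) := by
  rw [show 4 * n + 4 * c = 2 * (2 * (n + c)) by ring,
    show 4 * n + (4 * c + 1) = 2 * (2 * (n + c)) + 1 by ring,
    show 4 * n + (4 * c + 2) = 2 * (2 * (n + c) + 1) by ring,
    show 4 * n + (4 * c + 3) = 2 * (2 * (n + c) + 1) + 1 by ring]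
  simp only [thueMorse_two_mul, thueMorse_two_mul_add_one, true_and]
  generalize thueMorse (n + c) = a
  decide +revert

theorem IsChange.eq_add_one {k : ℕ} (h : IsChange k) : thueMorse (k + 1) = thueMorse k + 1 :=
  (fin_two_ne_iff _ _).1 h

theorem eq_of_not_isChange {k : ℕ} (h : ¬ IsChange k) : thueMorse (k + 1) = thueMorse k :=
  (not_not.1 h).symm

theorem thueMorseFactor_four_mul_of_isChange {k : ℕ} (h : IsChange k) :
    ∃ a, thueMorseFactor (4 * k) 5 =
      [a, a + 1, a + 1, a, a + 1] := by
  refine ⟨thueMorse k, ?_⟩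
  have e0 := h.eq_add_one
  have b0 := thueMorse_four_mul_add k 0
  have b1 := thueMorse_four_mul_add k 1
  simp only [Nat.reduceMul, Nat.reduceAdd, add_zero, zero_add] at e0 b0 b1
  simp only [thueMorseFactor, List.range_succ, List.range_zero, List.nil_append, List.map_cons,
    List.map_nil, List.cons_append, add_zero, b0, b1, e0]

theorem thueMorseFactor_four_mul_add_three_of_isChange {k : ℕ} (h : IsChange k) :
    ∃ a, thueMorseFactor (4 * k + 3) 5 =
      [a, a + 1, a, a, a + 1] := by
  refine ⟨thueMorse k, ?_⟩
  have e0 := h.eq_add_one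
  have b0 := thueMorse_four_mul_add k 0
  have b1 := thueMorse_four_mul_add k 1
  simp only [Nat.reduceMul, Nat.reduceAdd, add_zero, zero_add] at e0 b0 b1
  simp only [thueMorseFactor, List.range_succ, List.range_zero, List.nil_append, List.map_cons,
    List.map_nil, List.cons_append, add_zero, add_assoc, Nat.reduceAdd,
    b0, b1, e0]
  generalize thueMorse k = a
  decide +revert

theorem thueMorseFactor_four_mul_add_three_of_isChange_of_isChange {k : ℕ}
    (h0 : IsChange k) (h1 : IsChange (k + 1)) :
    ∃ a, thueMorseFactor (4 * k + 3) 6 =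
      [a, a + 1, a, a, a + 1, a] := by
  refine ⟨thueMorse k, ?_⟩
  have e0 := h0.eq_add_one
  have e1 := h1.eq_add_one
  have b0 := thueMorse_four_mul_add k 0
  have b1 := thueMorse_four_mul_add k 1
  have b2 := thueMorse_four_mul_add k 2
  simp only [Nat.reduceMul, Nat.reduceAdd, add_zero, zero_add, add_assoc] at e0 e1 b0 b1 b2
  simp only [thueMorseFactor, List.range_succ, List.range_zero, List.nil_append, List.map_cons,
    List.map_nil, List.cons_append, add_zero, add_assoc, Nat.reduceAdd,
    b0, b1, b2, e0, e1]
  generalize thueMorse k = a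
  decide +revert

theorem thueMorseFactor_four_mul_add_two_of_isChange_of_not {k : ℕ}
    (h0 : IsChange k) (h1 : ¬ IsChange (k + 1)) :
    ∃ a, thueMorseFactor (4 * k + 2) 10 =
      [a, a + 1, a, a + 1, a + 1, a, a, a + 1, a + 1, a] := by
  refine ⟨thueMorse k + 1, ?_⟩
  have e0 := h0.eq_add_one
  have e1 := eq_of_not_isChange h1
  have b0 := thueMorse_four_mul_add k 0
  have b1 := thueMorse_four_mul_add k 1
  have b2 := thueMorse_four_mul_add k 2
  simp only [Nat.reduceMul, Nat.reduceAdd, add_zero, zero_add, add_assoc] at e0 e1 b0 b1 b2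
  simp only [thueMorseFactor, List.range_succ, List.range_zero, List.nil_append, List.map_cons,
    List.map_nil, List.cons_append, add_zero, add_assoc, Nat.reduceAdd,
    b0, b1, b2, e0, e1]
  generalize thueMorse k = a
  decide +revert

theorem thueMorseFactor_four_mul_add_three_of_alternating_isChange {k : ℕ}
    (h0 : IsChange k) (h1 : ¬ IsChange (k + 1)) (h2 : IsChange (k + 2)) (h3 : ¬ IsChange (k + 3)) :
    ∃ a, thueMorseFactor (4 * k + 3) 14 =
      [a, a + 1, a, a, a + 1, a + 1, a, a, a + 1, a, a + 1, a + 1, a, a] := by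
  refine ⟨thueMorse k, ?_⟩
  have e0 := h0.eq_add_one
  have e1 := eq_of_not_isChange h1
  have e2 := h2.eq_add_one
  have e3 := eq_of_not_isChange h3
  have b0 := thueMorse_four_mul_add k 0
  have b1 := thueMorse_four_mul_add k 1
  have b2 := thueMorse_four_mul_add k 2
  have b3 := thueMorse_four_mul_add k 3
  have b4 := thueMorse_four_mul_add k 4
  simp only [Nat.reduceMul, Nat.reduceAdd, add_zero, zero_add,
    add_assoc] at e0 e1 e2 e3 b0 b1 b2 b3 b4
  simp only [thueMorseFactor, List.range_succ, List.range_zero, List.nil_append, List.map_cons,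
    List.map_nil, List.cons_append, add_zero, add_assoc, Nat.reduceAdd,
    b0, b1, b2, b3, b4, e0, e1, e2, e3]
  generalize thueMorse k = a
  decide +revert

theorem isLeftEnd_of_isChange {k : ℕ} (h : IsChange k) :
    IsLeftEnd (4 * k) := by
  obtain ⟨a, ha⟩ := thueMorseFactor_four_mul_of_isChange h
  exact hasOverlap_eraseIdx_of_take_eq _ (thueMorseFactor_mem_overlapFreeWords _ _) a
    (Or.inl <| (take_thueMorseFactor_add _ 5 10).trans ha)

theorem isLeftEnd_of_isChange_of_isChange {k : ℕ} (h₀ : IsChange k) (h₁ : IsChange (k + 1)) :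
    IsLeftEnd (4 * k + 3) := by
  obtain ⟨a, ha⟩ := thueMorseFactor_four_mul_add_three_of_isChange_of_isChange h₀ h₁
  exact hasOverlap_eraseIdx_of_take_eq _ (thueMorseFactor_mem_overlapFreeWords _ _) a
    (Or.inr <| Or.inl <| (take_thueMorseFactor_add _ 6 9).trans ha)

theorem isLeftEnd_of_isChange_of_not {k : ℕ} (h₀ : IsChange k) (h₁ : ¬ IsChange (k + 1)) :
    IsLeftEnd (4 * k + 2) := by
  obtain ⟨a, ha⟩ := thueMorseFactor_four_mul_add_two_of_isChange_of_not h₀ h₁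
  exact hasOverlap_eraseIdx_of_take_eq _ (thueMorseFactor_mem_overlapFreeWords _ _) a
    (Or.inr <| Or.inr <| Or.inl <| (take_thueMorseFactor_add _ 10 5).trans ha)

theorem isLeftEnd_of_alternating_isChange {k : ℕ} (h₀ : IsChange k) (h₁ : ¬ IsChange (k + 1))
    (h₂ : IsChange (k + 2)) (h₃ : ¬ IsChange (k + 3)) :
    IsLeftEnd (4 * k + 3) := by
  obtain ⟨a, ha⟩ := thueMorseFactor_four_mul_add_three_of_alternating_isChange h₀ h₁ h₂ h₃
  exact hasOverlap_eraseIdx_of_take_eq _ (thueMorseFactor_mem_overlapFreeWords _ _) a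
    (Or.inr <| Or.inr <| Or.inr <| (take_thueMorseFactor_add _ 14 1).trans ha)

theorem isRightEnd_of_isChange {i k : ℕ} (h : IsChange k)
    (hi : i + 10 = 4 * k + 3) : IsRightEnd i := by
  obtain ⟨a, ha⟩ := thueMorseFactor_four_mul_add_three_of_isChange h
  exact hasOverlap_eraseIdx_of_drop_eq _ (thueMorseFactor_mem_overlapFreeWords _ _) a
    (Or.inl <| (drop_thueMorseFactor_add _ 10 5).trans (hi ▸ ha))

theorem isRightEnd_of_isChange_of_isChange {i k : ℕ} (h₀ : IsChange k) (h₁ : IsChange (k + 1))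
    (hi : i + 9 = 4 * k + 3) : IsRightEnd i := by
  obtain ⟨a, ha⟩ := thueMorseFactor_four_mul_add_three_of_isChange_of_isChange h₀ h₁
  exact hasOverlap_eraseIdx_of_drop_eq _ (thueMorseFactor_mem_overlapFreeWords _ _) a
    (Or.inr <| (drop_thueMorseFactor_add _ 9 6).trans (hi ▸ ha))

theorem isChange_of_even {n : ℕ} (h : n % 2 = 0) : IsChange n := by
  rw [show n = 2 * (n / 2) by omega]
  exact isChange_two_mul _

theorem isChange_iff_not {n m : ℕ} (h : n = 2 * m + 1) : IsChange n ↔ ¬ IsChange m :=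
  h ▸ isChange_two_mul_add_one m

theorem not_isChange_of_mod_four {n : ℕ} (h : n % 4 = 1) : ¬ IsChange n := by
  rw [isChange_iff_not (m := n / 2) (by omega), not_not]
  exact isChange_of_even (by omega)

theorem isChange_iff {n m : ℕ} (h : n = 4 * m + 3) : IsChange n ↔ IsChange m := by
  rw [isChange_iff_not (m := 2 * m + 1) (by omega), isChange_two_mul_add_one, not_not]

theorem exists_isChange_and_isChange_add (e : ℕ) : ∃ k, IsChange k ∧ IsChange (k + e) := by
  rcases Nat.mod_two_eq_zero_or_one e with h | h
  · exact ⟨0, isChange_of_even rfl, isChange_of_even (by omega)⟩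
  · exact ⟨3, (isChange_iff rfl).2 (isChange_of_even (n := 0) rfl), isChange_of_even (by omega)⟩

theorem exists_isChange_and_not_isChange_add (g : ℕ) (hg : 0 < g) :
    (∃ b, IsChange b ∧ ¬ IsChange (b + g)) ∧ ∃ b, ¬ IsChange b ∧ IsChange (b + g) := by
  induction g using Nat.strong_induction_on with
  | _ g ih =>
  obtain ⟨q, rfl | rfl⟩ := Nat.even_or_odd' g
  · obtain ⟨⟨b, hb, hb'⟩, c, hc, hc'⟩ := ih q (by omega) (by omega)
    refine ⟨⟨2 * c + 1, ?_, ?_⟩, 2 * b + 1, ?_, ?_⟩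
    · rwa [isChange_two_mul_add_one]
    · rwa [isChange_iff_not (m := c + q) (by ring), not_not]
    · rwa [isChange_two_mul_add_one, not_not]
    · rwa [isChange_iff_not (m := b + q) (by ring)]
  · exact ⟨⟨2 * q, isChange_two_mul q, not_isChange_of_mod_four (by omega)⟩,
      1, not_isChange_of_mod_four rfl, isChange_of_even (by omega)⟩

/-- Two consecutive changes. -/
def IsDoubleChange (n : ℕ) : Prop := IsChange n ∧ IsChange (n + 1)

theorem isDoubleChange_of_isChange {n m : ℕ} (hm : IsChange m)
    (h : n = 4 * m + 2 ∨ n = 4 * m + 3) : IsDoubleChange n := by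
  rcases h with h | h
  · exact ⟨isChange_of_even (by omega), (isChange_iff (by omega)).2 hm⟩
  · exact ⟨(isChange_iff h).2 hm, isChange_of_even (by omega)⟩

theorem exists_isChange_and_isDoubleChange_add (e : ℕ) :
    ∃ k, IsChange k ∧ IsDoubleChange (k + e) := by
  have h : IsChange (2 * (e / 4)) := isChange_two_mul _
  rcases lt_or_ge (e % 4) 2 with he | he
  · exact ⟨4 * (e / 4) + 2, isChange_of_even (by omega), isDoubleChange_of_isChange h (by omega)⟩
  · exact ⟨4 * (e / 4), isChange_of_even (by omega), isDoubleChange_of_isChange h (by omega)⟩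

theorem exists_isChange_not_isChange_and_isDoubleChange_add {e : ℕ} (h₂ : 2 ≤ e) :
    ∃ k, (IsChange k ∧ ¬ IsChange (k + 1)) ∧ IsDoubleChange (k + e) := by
  rcases lt_or_ge (e % 4) 2 with he | he
  · obtain ⟨b, hb, hb'⟩ := (exists_isChange_and_not_isChange_add (e / 4) (by omega)).2
    refine ⟨4 * b + 2, ⟨isChange_of_even (by omega), ?_⟩,
      isDoubleChange_of_isChange hb' (by omega)⟩
    rwa [isChange_iff (m := b) (by omega)]
  · exact ⟨4 * (e / 4), ⟨isChange_of_even (by omega), not_isChange_of_mod_four (by omega)⟩,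
      isDoubleChange_of_isChange (isChange_two_mul (e / 4)) (by omega)⟩

theorem exists_isDoubleChange_and_isDoubleChange_add {e : ℕ} (he : e % 4 ≠ 2) :
    ∃ k, IsDoubleChange k ∧ IsDoubleChange (k + e) := by
  obtain ⟨a, ha, ha'⟩ := exists_isChange_and_isChange_add ((e + 1) / 4)
  rcases eq_or_ne (e % 4) 3 with h | h
  · exact ⟨4 * a + 3, isDoubleChange_of_isChange ha (by omega),
      isDoubleChange_of_isChange ha' (by omega)⟩
  · exact ⟨4 * a + 2, isDoubleChange_of_isChange ha (by omega),
      isDoubleChange_of_isChange ha' (by omega)⟩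

theorem exists_alternating_isChange_and_isDoubleChange_add {e : ℕ} (he : e % 4 = 2)
    (h₂ : 2 < e) :
    ∃ k, (IsChange k ∧ ¬ IsChange (k + 1) ∧ IsChange (k + 2) ∧ ¬ IsChange (k + 3)) ∧
      IsDoubleChange (k + e) := by
  obtain ⟨b, hb, hb'⟩ : ∃ b, IsChange b ∧ IsChange (2 * b + 1 + e / 4) := by
    rcases Nat.mod_two_eq_zero_or_one (e / 4) with h | h
    · obtain ⟨b, hb, hb'⟩ := (exists_isChange_and_not_isChange_add (e / 8) (by omega)).1
      exact ⟨b, hb, (isChange_iff_not (by omega)).2 hb'⟩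
    · exact ⟨0, isChange_of_even rfl, isChange_of_even (by omega)⟩
  refine ⟨8 * b + 4, ⟨isChange_of_even (by omega), not_isChange_of_mod_four (by omega),
    isChange_of_even (by omega), ?_⟩, isDoubleChange_of_isChange hb' (by omega)⟩
  rwa [isChange_iff (m := 2 * b + 1) (by omega), isChange_two_mul_add_one, not_not]

theorem exists_irreducibleOverlapFree {n : ℕ} (hn : 15 ≤ n) :
    ∃ w : List (Fin 2), w.length = n ∧ IrreducibleOverlapFree w := by
  obtain ⟨m, rfl⟩ := Nat.exists_eq_add_of_le' hn
  suffices h : ∃ i, IsLeftEnd i ∧ IsRightEnd (i + m) by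
    obtain ⟨i, hl, hr⟩ := h
    exact ⟨_, length_thueMorseFactor i _, irreducibleOverlapFree_thueMorseFactor hl hr⟩
  have h4 : m % 4 = 0 ∨ m % 4 = 1 ∨ m % 4 = 2 ∨ m % 4 = 3 := by omega
  rcases h4 with h | h | h | h
  · obtain ⟨k, hk, hk'⟩ :=
      exists_isChange_not_isChange_and_isDoubleChange_add (e := m / 4 + 2) (by omega)
    exact ⟨4 * k + 2, isLeftEnd_of_isChange_of_not hk.1 hk.2,
      isRightEnd_of_isChange_of_isChange hk'.1 hk'.2 (by omega)⟩
  · obtain ⟨k, hk, hk'⟩ := exists_isChange_and_isChange_add (m / 4 + 2)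
    exact ⟨4 * k, isLeftEnd_of_isChange hk, isRightEnd_of_isChange hk' (by omega)⟩
  · obtain ⟨k, hk, hk'⟩ := exists_isChange_and_isDoubleChange_add (m / 4 + 2)
    exact ⟨4 * k, isLeftEnd_of_isChange hk,
      isRightEnd_of_isChange_of_isChange hk'.1 hk'.2 (by omega)⟩
  · rcases eq_or_ne ((m / 4 + 3) % 4) 2 with he | he
    · obtain ⟨k, hk, hk'⟩ := exists_alternating_isChange_and_isDoubleChange_add he (by omega)
      exact ⟨4 * k + 3, isLeftEnd_of_alternating_isChange hk.1 hk.2.1 hk.2.2.1 hk.2.2.2,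
        isRightEnd_of_isChange_of_isChange hk'.1 hk'.2 (by omega)⟩
    · obtain ⟨k, hk, hk'⟩ := exists_isDoubleChange_and_isDoubleChange_add he
      exact ⟨4 * k + 3, isLeftEnd_of_isChange_of_isChange hk.1 hk.2,
        isRightEnd_of_isChange_of_isChange hk'.1 hk'.2 (by omega)⟩

theorem exists_mem_overlapFreeWords_irreducibleOverlapFree_iff :
    ∀ n < 15, (∃ w ∈ overlapFreeWords n, IrreducibleOverlapFree w) ↔
      (n = 6 ∨ n = 8 ∨ n = 9 ∨ n = 10 ∨ 12 ≤ n) := by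
  decide +kernel

theorem length_of_mem_overlapFreeWords {n : ℕ} {w : List (Fin 2)} (h : w ∈ overlapFreeWords n) :
    w.length = n := by
  induction n generalizing w with
  | zero => simpa [overlapFreeWords] using h
  | succ n ih =>
    simp only [overlapFreeWords, List.mem_filter, List.mem_flatMap] at h
    obtain ⟨⟨v, hv, hw⟩, -⟩ := h
    have := ih hv
    simp only [List.mem_cons, List.not_mem_nil, or_false] at hw
    rcases hw with rfl | rfl <;> simpa

theorem irreducible_overlapFree_lengths (n : ℕ) :
    (∃ w : List (Fin 2), w.length = n ∧ IrreducibleOverlapFree w) ↔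
      (n = 6 ∨ n = 8 ∨ n = 9 ∨ n = 10 ∨ 12 ≤ n) := by
  rcases lt_or_ge n 15 with hn | hn
  · rw [← exists_mem_overlapFreeWords_irreducibleOverlapFree_iff n hn]
    constructor
    · rintro ⟨w, rfl, hw⟩
      exact ⟨w, hw.1.mem_overlapFreeWords, hw⟩
    · rintro ⟨w, hw, hw'⟩
      exact ⟨w, length_of_mem_overlapFreeWords hw, hw'⟩
  · exact iff_of_true (exists_irreducibleOverlapFree hn) (by omega)
end

section
/- There exists an irreducible cubefree binary word of length n if and only if n ∈ {10, 14, 18, 19, 20} or n ≥ 22. -/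
/-- A cube is a word of the form XXX with X nonempty. -/
def IsCube {α : Type*} (w : List α) : Prop :=
  ∃ X : List α, X ≠ [] ∧ w = X ++ X ++ X

/-- A word contains a cube if some factor (contiguous subword) of it is a cube. -/
def HasCube {α : Type*} (w : List α) : Prop :=
  ∃ u, u <:+: w ∧ IsCube u

/-- A word is cubefree if none of its factors is a cube. -/
def CubeFree {α : Type*} (w : List α) : Prop := ¬ HasCube w

/-- An irreducible cubefree word: a cubefree word of length at least 3
such that removing any one interior letter creates a cube. -/
def IrreducibleCubeFree (w : List (Fin 2)) : Prop :=
  CubeFree w ∧ 3 ≤ w.length ∧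
    ∀ i : ℕ, 0 < i → i + 1 < w.length → HasCube (w.eraseIdx i)

namespace IrreducibleCubeFreeLengths

/-! ### Words as Boolean sequences -/

/-- The binary word of length `n` whose letters are the first `n` values of `f`. -/
def toWord (n : ℕ) (f : ℕ → Bool) : List (Fin 2) :=
  (List.range n).map fun i => if f i then 1 else 0

/-- The sequence `f` has a cube of period `q` starting at position `s`. -/
def CubeAt (f : ℕ → Bool) (s q : ℕ) : Prop :=
  0 < q ∧ ∀ i < 2 * q, f (s + i) = f (s + i + q)

/-- The sequence `f` with its `j`-th term removed. -/
def eraseSeq (f : ℕ → Bool) (j : ℕ) (i : ℕ) : Bool :=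
  if i < j then f i else f (i + 1)

@[simp]
theorem length_toWord (n : ℕ) (f : ℕ → Bool) : (toWord n f).length = n := by
  simp [toWord]

theorem getElem_toWord {n : ℕ} {f : ℕ → Bool} {i : ℕ} (h : i < (toWord n f).length) :
    (toWord n f)[i] = if f i then 1 else 0 := by
  simp [toWord]

theorem exists_toWord_eq (w : List (Fin 2)) : ∃ f, toWord w.length f = w := by
  refine ⟨fun i => w[i]? == some 1, List.ext_getElem (by simp) fun i h₁ h₂ => ?_⟩
  rw [getElem_toWord]
  have : w[i] = 0 ∨ w[i] = 1 := by omega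
  rcases this with h | h <;> simp [h, h₂]

theorem eraseIdx_toWord {n j : ℕ} (f : ℕ → Bool) (h : j < n) :
    (toWord n f).eraseIdx j = toWord (n - 1) (eraseSeq f j) := by
  apply List.ext_getElem
  · simp [List.length_eraseIdx, h]
  · intro i h₁ h₂
    rw [List.getElem_eraseIdx]
    split <;> simp_all [getElem_toWord, eraseSeq]

theorem hasCube_iff {α : Type*} (w : List α) :
    HasCube w ↔ ∃ s q, 0 < q ∧ s + 3 * q ≤ w.length ∧
      ∀ i < 2 * q, w[s + i]? = w[s + i + q]? := by
  constructor
  · rintro ⟨u, ⟨a, b, rfl⟩, X, hX, rfl⟩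
    refine ⟨a.length, X.length, List.length_pos_iff.2 hX, by simp; omega, fun i hi => ?_⟩
    have key : ∀ k < 3 * X.length,
        (a ++ (X ++ X ++ X) ++ b)[a.length + k]? = (X ++ X ++ X)[k]? := by
      intro k hk
      rw [List.getElem?_append_left (by simp; omega), List.getElem?_append_right (by omega),
        Nat.add_sub_cancel_left]
    rw [Nat.add_assoc, key _ (by omega), key _ (by omega),
      List.getElem?_append_left (by simp; omega), List.append_assoc,
      List.getElem?_append_right (l₁ := X) (i := i + X.length) (by omega), Nat.add_sub_cancel]
  · rintro ⟨s, q, hq, hs, h⟩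
    refine ⟨(w.drop s).take (3 * q),
      (List.take_prefix _ _).isInfix.trans (List.drop_suffix _ _).isInfix,
      (w.drop s).take q, ?_, ?_⟩
    · rw [← List.length_pos_iff]
      simp
      omega
    · apply List.ext_getElem?
      intro i
      by_cases h₁ : i < q
      · rw [List.append_assoc, List.getElem?_append_left (by simp; omega)]
        simp [h₁, show i < 3 * q by omega]
      by_cases h₂ : i < 2 * q
      · rw [List.append_assoc, List.getElem?_append_right (by simp; omega),
          List.getElem?_append_left (by simp; omega)]
        have := h (i - q) (by omega)
        rw [show s + (i - q) + q = s + i by omega] at this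
        have hl : min q (w.length - s) = q := by omega
        rw [List.getElem?_take_of_lt (by omega), List.getElem?_drop, ← this, List.length_take,
          List.length_drop, hl, List.getElem?_take_of_lt (by omega), List.getElem?_drop]
      by_cases h₃ : i < 3 * q
      · rw [List.getElem?_append_right (by simp; omega)]
        have h₄ := h (i - q) (by omega)
        have h₅ := h (i - 2 * q) (by omega)
        rw [show s + (i - q) + q = s + i by omega] at h₄
        rw [show s + (i - 2 * q) + q = s + (i - q) by omega] at h₅
        have hl : min q (w.length - s) = q := by omega
        simp [List.getElem?_take, hl, h₃, show i - (q + q) = i - 2 * q by omega, h₅, h₄]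
        intro
        omega
      · rw [List.getElem?_eq_none (by simp; omega), List.getElem?_eq_none (by simp; omega)]

theorem hasCube_toWord (n : ℕ) (f : ℕ → Bool) :
    HasCube (toWord n f) ↔ ∃ s q, s + 3 * q ≤ n ∧ CubeAt f s q := by
  rw [hasCube_iff]
  constructor
  · rintro ⟨s, q, hq, hs, h⟩
    rw [length_toWord] at hs
    refine ⟨s, q, hs, hq, fun i hi => ?_⟩
    have := h i hi
    rw [List.getElem?_eq_getElem (by simp; omega), List.getElem?_eq_getElem (by simp; omega),
      getElem_toWord, getElem_toWord] at this
    cases h₁ : f (s + i) <;> cases h₂ : f (s + i + q) <;> simp_all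
  · rintro ⟨s, q, hs, hq, h⟩
    refine ⟨s, q, hq, by simpa using hs, fun i hi => ?_⟩
    rw [List.getElem?_eq_getElem (by simp; omega), List.getElem?_eq_getElem (by simp; omega),
      getElem_toWord, getElem_toWord, h i hi]

theorem irreducibleCubeFree_toWord (n : ℕ) (f : ℕ → Bool) :
    IrreducibleCubeFree (toWord n f) ↔
      (∀ s q, s + 3 * q ≤ n → ¬ CubeAt f s q) ∧ 3 ≤ n ∧
        ∀ j, 0 < j → j + 1 < n → ∃ s q, s + 3 * q ≤ n - 1 ∧ CubeAt (eraseSeq f j) s q := by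
  simp only [IrreducibleCubeFree, CubeFree, hasCube_toWord, length_toWord]
  push Not
  refine and_congr_right fun _ => and_congr_right fun _ => forall_congr' fun j =>
    forall_congr' fun _ => forall_congr' fun hj => ?_
  rw [eraseIdx_toWord f (by omega), hasCube_toWord]

theorem irreducibleCubeFree_toWord_not {n : ℕ} {f : ℕ → Bool}
    (h : IrreducibleCubeFree (toWord n f)) : IrreducibleCubeFree (toWord n fun i => !f i) := by
  have hcube : ∀ (g : ℕ → Bool) (s q : ℕ), CubeAt (fun i => !g i) s q ↔ CubeAt g s q := by
    simp [CubeAt]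
  have herase : ∀ j, eraseSeq (fun i => !f i) j = fun i => !eraseSeq f j i := by
    intro j
    funext i
    simp only [eraseSeq]
    split <;> rfl
  rw [irreducibleCubeFree_toWord] at h ⊢
  simpa only [herase, hcube] using h

/-- A cube created by deleting a term of the sequence `g` occurs in `f` as soon as `f` and `g`
agree, up to a shift, on the window containing that cube. -/
theorem exists_cubeAt_eraseSeq_of_window {f g : ℕ → Bool} {k l m n : ℕ}
    (hfg : ∀ i < l, f (k + i) = g i) (hn : k + l ≤ n)
    (h : ∃ s q, s + 3 * q ≤ l - 1 ∧ CubeAt (eraseSeq g m) s q) :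
    ∃ s q, s + 3 * q ≤ n - 1 ∧ CubeAt (eraseSeq f (k + m)) s q := by
  obtain ⟨s, q, hs, hq, h⟩ := h
  have key : ∀ i < l - 1, eraseSeq f (k + m) (k + i) = eraseSeq g m i := by
    intro i hi
    simp only [eraseSeq, Nat.add_lt_add_iff_left, Nat.add_assoc]
    rw [hfg i (by omega), hfg (i + 1) (by omega)]
  refine ⟨k + s, q, by omega, hq, fun i hi => ?_⟩
  rw [show k + s + i + q = k + (s + i + q) by omega, Nat.add_assoc k s i,
    key _ (by omega), key _ (by omega)]
  exact h i hi

/-! ### Words encoded as the binary digits of a natural number, lowest digit first -/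

/-- Decides whether the digits of `N` have a cube of period `q` starting at position `s`. It is
written without notation so that the kernel evaluates it without unfolding instances. -/
def cubeAtB (N s q : ℕ) : Bool :=
  Nat.beq (Nat.mod (Nat.xor (Nat.shiftRight N s) (Nat.shiftRight N (Nat.add s q)))
    (Nat.pow 2 (Nat.mul 2 q))) 0

/-- Looks for a cube of period at most `Q` starting before position `k` among the first `n`
digits of `N`. -/
def hasCubeB (k Q N n : ℕ) : Bool :=
  (List.range Q).any fun q =>
    (List.range (min k (n - 3 * q - 2))).any fun s => cubeAtB N s (q + 1)

/-- The number obtained by removing the digit of `N` in position `j`. -/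
def eraseBit (N j : ℕ) : ℕ :=
  (N % 2 ^ j) ||| ((N >>> (j + 1)) <<< j)

/-- Decides whether deleting any interior letter from the word formed by the first `n` digits of
`N` creates a cube of period at most `Q` that starts before the deleted letter. -/
def allDeletionsB (Q N n : ℕ) : Bool :=
  (List.range (n - 2)).all fun j => hasCubeB (j + 1) Q (eraseBit N (j + 1)) (n - 1)

theorem cubeAtB_iff_mod_eq_zero {N s q : ℕ} :
    cubeAtB N s q = true ↔ ((N >>> s) ^^^ (N >>> (s + q))) % 2 ^ (2 * q) = 0 := by
  rw [cubeAtB, Nat.beq_eq]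
  rfl

theorem cubeAtB_iff {N s q : ℕ} (hq : 0 < q) :
    cubeAtB N s q = true ↔ CubeAt N.testBit s q := by
  simp only [cubeAtB_iff_mod_eq_zero, CubeAt, hq, true_and]
  constructor
  · intro h i hi
    have := congrArg (Nat.testBit · i) h
    simpa [Nat.testBit_mod_two_pow, hi, Nat.testBit_shiftRight, Nat.add_right_comm s q i]
      using this
  · intro h
    apply Nat.eq_of_testBit_eq
    intro i
    by_cases hi : i < 2 * q
    · simp [Nat.testBit_mod_two_pow, hi, Nat.testBit_shiftRight, Nat.add_right_comm s q i, h i hi]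
    · simp [Nat.testBit_mod_two_pow, hi]

theorem testBit_eraseBit (N j : ℕ) : (eraseBit N j).testBit = eraseSeq N.testBit j := by
  funext i
  by_cases h : i < j
  · simp [eraseBit, eraseSeq, Nat.testBit_mod_two_pow, Nat.testBit_shiftLeft, h, h.not_ge]
  · have : j + 1 + (i - j) = i + 1 := by omega
    simp [eraseBit, eraseSeq, Nat.testBit_mod_two_pow, Nat.testBit_shiftLeft,
      Nat.testBit_shiftRight, h, not_lt.1 h, this]

theorem hasCubeB_iff {k Q N n : ℕ} : hasCubeB k Q N n = true ↔
    ∃ s q, s < k ∧ q ≤ Q ∧ s + 3 * q ≤ n ∧ CubeAt N.testBit s q := by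
  simp only [hasCubeB, List.any_eq_true, List.mem_range]
  constructor
  · rintro ⟨q, hq, s, hs, h⟩
    exact ⟨s, q + 1, by omega, hq, by omega, (cubeAtB_iff (by omega)).1 h⟩
  · rintro ⟨s, q, hk, hq, hs, h⟩
    have := h.1
    refine ⟨q - 1, by omega, s, by omega, ?_⟩
    rw [cubeAtB_iff (by omega), Nat.sub_add_cancel this]
    exact h

theorem irreducibleCubeFree_of_allDeletionsB {Q N n : ℕ} (hn : 3 ≤ n)
    (h₁ : hasCubeB n n N n = false) (h₂ : allDeletionsB Q N n = true) :
    IrreducibleCubeFree (toWord n N.testBit) := by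
  simp only [allDeletionsB, List.all_eq_true, List.mem_range] at h₂
  rw [irreducibleCubeFree_toWord]
  refine ⟨fun s q hs hc => ?_, hn, fun j hj hjn => ?_⟩
  · have := hc.1
    rw [hasCubeB_iff.2 ⟨s, q, by omega, by omega, hs, hc⟩] at h₁
    cases h₁
  · have := h₂ (j - 1) (by omega)
    rw [Nat.sub_add_cancel hj, hasCubeB_iff, testBit_eraseBit] at this
    obtain ⟨s, q, -, -, hs, hc⟩ := this
    exact ⟨s, q, hs, hc⟩

theorem allDeletionsB_of_irreducibleCubeFree {N n : ℕ}
    (h : IrreducibleCubeFree (toWord n N.testBit)) : allDeletionsB (n / 3) N n = true := by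
  rw [irreducibleCubeFree_toWord] at h
  obtain ⟨h₁, -, h₃⟩ := h
  simp only [allDeletionsB, List.all_eq_true, List.mem_range]
  intro j hj
  obtain ⟨s, q, hs, hc⟩ := h₃ (j + 1) (by omega) (by omega)
  refine hasCubeB_iff.2 ⟨s, q, ?_, by omega, hs, (testBit_eraseBit N _).symm ▸ hc⟩
  by_contra! hjs
  refine h₁ (s + 1) q (by omega) ⟨hc.1, fun i hi => ?_⟩
  have := hc.2 i hi
  rw [eraseSeq, eraseSeq, if_neg (by omega), if_neg (by omega)] at this
  rwa [show s + 1 + i = s + i + 1 by omega, show s + i + 1 + q = s + i + q + 1 by omega]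

/-! ### Lengths without irreducible cubefree words -/

/-- The lengths below `22` of irreducible cubefree words. -/
def isExceptional (n : ℕ) : Bool :=
  n == 10 || n == 14 || n == 18 || n == 19 || n == 20

/-- Applies `f` to `n` after evaluating `n`, which keeps kernel computations from duplicating
unevaluated arguments. -/
def force (n : ℕ) (f : ℕ → Bool) : Bool :=
  match n with
  | 0 => f 0
  | k + 1 => f (k + 1)

theorem force_eq (n : ℕ) (f : ℕ → Bool) : force n f = f n := by
  cases n <;> rfl

/-- Depth-first search through the cubefree words ending in the first `n` digits of `N` and
exceeding them by fewer than `d` letters, checking that none of those of length at least `3` that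
are not of exceptional length is irreducible. -/
def noIrreducibleB : ℕ → ℕ → ℕ → Bool
  | 0, _, _ => true
  | d + 1, n, N =>
    hasCubeB 1 (n / 3) N n ||
      ((n < 3 || isExceptional n || !allDeletionsB (n / 3) N n) &&
        force n fun n => force N fun N =>
          noIrreducibleB d (n + 1) (2 * N) && noIrreducibleB d (n + 1) (2 * N + 1))

theorem isExceptional_of_noIrreducibleB {d n N t M : ℕ} (h : noIrreducibleB d n N = true)
    (ht : t < d) (hM : M >>> t = N) (hi : IrreducibleCubeFree (toWord (n + t) M.testBit)) :
    isExceptional (n + t) = true := by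
  induction d generalizing n N t with
  | zero => omega
  | succ d ih =>
    simp only [noIrreducibleB, force_eq, Bool.or_eq_true, Bool.and_eq_true] at h
    rcases h with h | ⟨h₁, h₂, h₃⟩
    · obtain ⟨s, q, hs, -, hsq, hc⟩ := hasCubeB_iff.1 h
      obtain rfl : s = 0 := by omega
      refine absurd ?_ (((irreducibleCubeFree_toWord _ _).1 hi).1 t q (by omega))
      refine ⟨hc.1, fun i hi => ?_⟩
      have := hc.2 i hi
      simpa [← hM, Nat.testBit_shiftRight, Nat.add_assoc] using this
    · rcases Nat.eq_zero_or_pos t with rfl | htpos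
      · have hM' : M = N := by simpa using hM
        subst hM'
        rw [Nat.add_zero] at hi ⊢
        have h₄ := allDeletionsB_of_irreducibleCubeFree hi
        have h₅ := ((irreducibleCubeFree_toWord _ _).1 hi).2.1
        simpa [h₄, h₅.not_gt] using h₁
      · have hdiv : (M >>> (t - 1)) / 2 = N := by
          rw [← hM, ← Nat.shiftRight_succ, Nat.sub_add_cancel htpos]
        have hlen : n + 1 + (t - 1) = n + t := by omega
        rw [← hlen] at hi ⊢
        rcases Nat.mod_two_eq_zero_or_one (M >>> (t - 1)) with h | h
        · exact ih h₂ (by omega) (by omega) hi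
        · exact ih h₃ (by omega) (by omega) hi

set_option maxHeartbeats 4000000 in
theorem noIrreducibleB_zero : noIrreducibleB 21 1 0 = true := by
  decide +kernel

theorem isExceptional_of_irreducibleCubeFree {w : List (Fin 2)} (hw : IrreducibleCubeFree w)
    (hlt : w.length < 22) : isExceptional w.length = true := by
  obtain ⟨f, hf⟩ := exists_toWord_eq w
  generalize w.length = n at hf hlt
  subst hf
  have hn := ((irreducibleCubeFree_toWord _ _).1 hw).2.1
  obtain ⟨g, hg, hlast⟩ :
      ∃ g, IrreducibleCubeFree (toWord n g) ∧ g (n - 1) = false := by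
    cases h : f (n - 1)
    · exact ⟨f, hw, h⟩
    · exact ⟨fun i => !f i, irreducibleCubeFree_toWord_not hw, by simp [h]⟩
  obtain ⟨M, hM, hMg⟩ : ∃ M, M < 2 ^ n ∧ ∀ i < n, M.testBit i = g i :=
    ⟨Nat.ofBits fun i : Fin n => g i, Nat.ofBits_lt_two_pow _,
      fun i hi => by rw [Nat.testBit_ofBits_lt _ _ hi]⟩
  have hw' : toWord n M.testBit = toWord n g :=
    List.map_congr_left fun i hi => by rw [hMg i (List.mem_range.1 hi)]
  have hshift : M >>> (n - 1) = 0 := by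
    apply Nat.eq_of_testBit_eq
    intro i
    rw [Nat.testBit_shiftRight, Nat.zero_testBit]
    rcases Nat.eq_zero_or_pos i with rfl | hi
    · rw [Nat.add_zero, hMg _ (by omega), hlast]
    · exact Nat.testBit_lt_two_pow (hM.trans_le (Nat.pow_le_pow_right (by omega) (by omega)))
  have hlen : 1 + (n - 1) = n := by omega
  rw [← hlen]
  exact isExceptional_of_noIrreducibleB noIrreducibleB_zero (by omega) hshift
    (by rw [hlen, hw']; exact hg)

/-! ### Explicit short words -/

/-- Pairs `(n, N)` such that the first `n` digits of `N` form an irreducible cubefree word. -/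
def shortWords : List (ℕ × ℕ) :=
[(10, 722), (14, 4818), (18, 185042), (19, 152361), (20, 304722), (22, 2960685), (23, 5919529),
   (24, 11839058), (25, 9851689), (26, 40709421), (27, 40709421), (28, 78947922), (29, 378950441),
   (30, 651350745), (31, 1517104429), (32, 1302701490), (33, 6063484118), (34, 12126968109), (35,
   10107039021), (36, 48547341746), (37, 83372895446), (38, 83372895446), (39, 161712624345), (40,
   323425248690), (41, 1553514931794), (42, 3107029871830), (43, 6214059743533), (44,
   5174803977001), (45, 10349607954002), (46, 20699215916246), (47, 41398431832365), (49,
   165593727264045), (50, 331187454628649), (51, 662374909056210), (54, 5298999274022482), (55,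
   10597998544899373), (56, 21191599070565081)]

theorem shortWords_spec : ∀ x ∈ shortWords, 3 ≤ x.1 ∧
    hasCubeB x.1 x.1 x.2 x.1 = false ∧ allDeletionsB 8 x.2 x.1 = true := by
  decide +kernel

theorem exists_of_mem_shortWords {n : ℕ} (h : n ∈ shortWords.map Prod.fst) :
    ∃ w : List (Fin 2), w.length = n ∧ IrreducibleCubeFree w := by
  obtain ⟨⟨n, N⟩, hx, rfl⟩ := List.mem_map.1 h
  have := shortWords_spec _ hx
  exact ⟨_, length_toWord _ _, irreducibleCubeFree_of_allDeletionsB this.1 this.2.1 this.2.2⟩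

/-! ### An infinite cubefree word -/

/-- The number whose binary digits are the letters of the pattern defining `toeplitz`. -/
def pattern : ℕ := 53970

/-- The fixed point of the morphism `x ↦ x1001011010010110`. -/
def toeplitz (n : ℕ) : Bool :=
  if n % 17 ≠ 0 then pattern.testBit (n % 17)
  else if n = 0 then false
  else toeplitz (n / 17)
termination_by n
decreasing_by omega

theorem toeplitz_of_mod_ne {n : ℕ} (h : n % 17 ≠ 0) :
    toeplitz n = pattern.testBit (n % 17) := by
  rw [toeplitz, if_pos h]

theorem toeplitz_mul (n : ℕ) : toeplitz (17 * n) = toeplitz n := by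
  rcases Nat.eq_zero_or_pos n with rfl | h
  · rfl
  · rw [toeplitz, if_neg (by omega), if_neg (by omega), Nat.mul_div_cancel_left _ (by omega)]

theorem exists_pattern_mismatch :
    ∀ d < 17, d ≠ 0 → ∃ r < 17, r ≠ 0 ∧ (r + d) % 17 ≠ 0 ∧
      pattern.testBit r ≠ pattern.testBit ((r + d) % 17) := by
  decide +kernel

/-- If `17` consecutive letters are repeated at distance `q`, then `q` is a multiple of `17`. -/
theorem dvd_of_toeplitz_eq {s q : ℕ} (h : ∀ i < 17, toeplitz (s + i) = toeplitz (s + i + q)) :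
    17 ∣ q := by
  by_contra hq
  obtain ⟨r, hr, hr₀, hrq, hne⟩ := exists_pattern_mismatch (q % 17) (by omega) (by omega)
  have hi := h ((r + 17 - s % 17) % 17) (by omega)
  rw [toeplitz_of_mod_ne (by omega), toeplitz_of_mod_ne (by omega),
    show (s + (r + 17 - s % 17) % 17) % 17 = r by omega,
    show (s + (r + 17 - s % 17) % 17 + q) % 17 = (r + q % 17) % 17 by omega] at hi
  exact hne hi

/-- The image of the word `abc` under the morphism `x ↦ x1001011010010110`. -/
def threeBlocks (a b c : Bool) : ℕ :=
  (pattern + a.toNat) ||| ((pattern + b.toNat) <<< 17) ||| ((pattern + c.toNat) <<< 34)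

theorem testBit_threeBlocks : ∀ a b c : Bool, ∀ i < 51, (threeBlocks a b c).testBit i =
    if i % 17 ≠ 0 then pattern.testBit (i % 17)
    else if i = 0 then a else if i = 17 then b else c := by
  decide +kernel

theorem toeplitz_window (m : ℕ) {i : ℕ} (hi : i < 51) : toeplitz (17 * m + i) =
    (threeBlocks (toeplitz m) (toeplitz (m + 1)) (toeplitz (m + 2))).testBit i := by
  rw [testBit_threeBlocks _ _ _ i hi]
  split_ifs with h₁ h₂ h₃
  · rw [toeplitz_of_mod_ne (by omega), show (17 * m + i) % 17 = i % 17 by omega]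
  · rw [h₂, Nat.add_zero, toeplitz_mul]
  · rw [h₃, ← toeplitz_mul (m + 1), Nat.mul_add]
  · rw [← toeplitz_mul (m + 2), show 17 * m + i = 17 * (m + 2) by omega]

theorem not_cubeAtB_threeBlocks : ∀ a b c : Bool, ∀ s < 17, ∀ q < 9, 0 < q →
    cubeAtB (threeBlocks a b c) s q = false := by
  decide +kernel

theorem not_cubeAt_toeplitz (s q : ℕ) : ¬ CubeAt toeplitz s q := by
  induction q using Nat.strong_induction_on generalizing s with
  | _ q ih =>
    rintro ⟨hq, h⟩
    by_cases hq9 : q < 9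
    · have := not_cubeAtB_threeBlocks (toeplitz (s / 17)) (toeplitz (s / 17 + 1))
        (toeplitz (s / 17 + 2)) (s % 17) (by omega) q hq9 hq
      rw [← Bool.not_eq_true, cubeAtB_iff hq] at this
      refine this ⟨hq, fun i hi => ?_⟩
      rw [← toeplitz_window _ (by omega), ← toeplitz_window _ (by omega),
        show 17 * (s / 17) + (s % 17 + i) = s + i by omega,
        show 17 * (s / 17) + (s % 17 + i + q) = s + i + q by omega]
      exact h i hi
    · obtain ⟨q', rfl⟩ := dvd_of_toeplitz_eq (s := s) (q := q) fun i hi => h i (by omega)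
      refine ih q' (by omega) ((s + 16) / 17) ⟨by omega, fun i hi => ?_⟩
      have := h (17 * ((s + 16) / 17 + i) - s) (by omega)
      rw [show s + (17 * ((s + 16) / 17 + i) - s) = 17 * ((s + 16) / 17 + i) by omega,
        ← Nat.mul_add, toeplitz_mul, toeplitz_mul] at this
      exact this

theorem hasCubeB_threeBlocks : ∀ a b c : Bool, ∀ j < 43, 17 ≤ j →
    hasCubeB j 8 (eraseBit (threeBlocks a b c) j) 43 = true := by
  decide +kernel

/-! ### Long words -/

/-- The sequence consisting of the `p` lowest digits of `P` followed by `toeplitz`. -/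
def prepend (p P : ℕ) (n : ℕ) : Bool :=
  if n < p then P.testBit n else toeplitz (n - p)

theorem prepend_add (p P n : ℕ) : prepend p P (p + n) = toeplitz n := by
  simp [prepend]

/-- The number whose binary digits are the first `289` letters of `toeplitz`. -/
def toeplitzPrefix : ℕ :=
  (List.range 17).foldr (fun i N => (pattern + (pattern.testBit i).toNat) ||| (N <<< 17)) 0

theorem testBit_toeplitzPrefix : ∀ i < 289, toeplitzPrefix.testBit i =
    if i % 17 ≠ 0 then pattern.testBit (i % 17) else pattern.testBit (i / 17) := by
  decide +kernel

theorem toeplitz_eq_testBit {i : ℕ} (hi : i < 289) :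
    toeplitz i = toeplitzPrefix.testBit i := by
  rw [testBit_toeplitzPrefix i hi]
  split_ifs with h
  · exact toeplitz_of_mod_ne h
  · obtain ⟨k, rfl⟩ : 17 ∣ i := by omega
    rw [toeplitz_mul, Nat.mul_div_cancel_left _ (by omega)]
    rcases Nat.eq_zero_or_pos k with rfl | hk
    · rw [toeplitz]
      rfl
    · rw [toeplitz_of_mod_ne (by omega), Nat.mod_eq_of_lt (by omega)]

/-- The number whose binary digits are the first `p + 289` terms of `prepend p P`. -/
def prependPrefix (p P : ℕ) : ℕ :=
  (P % 2 ^ p) ||| (toeplitzPrefix <<< p)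

theorem prepend_eq_testBit {p P i : ℕ} (hi : i < p + 289) :
    prepend p P i = (prependPrefix p P).testBit i := by
  by_cases h : i < p
  · simp [prepend, prependPrefix, Nat.testBit_mod_two_pow, Nat.testBit_shiftLeft, h, h.not_ge]
  · simp [prepend, prependPrefix, Nat.testBit_mod_two_pow, Nat.testBit_shiftLeft, h, not_lt.1 h,
      toeplitz_eq_testBit (show i - p < 289 by omega)]

/-- Decides whether prepending the `p` lowest digits of `P` to `toeplitz` creates no short cube
and whether deleting an early letter from the result creates a cube. -/
def isHeadB (p P : ℕ) : Bool :=
  (0 < p && p < 30 && P.testBit (p - 1)) &&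
  ((List.range p).all fun s => (List.range (p + 16)).all fun q =>
    !cubeAtB (prependPrefix p P) s (q + 1)) &&
  ((List.range (p + 16)).all fun j =>
    hasCubeB (j + 1) 8 (eraseBit (prependPrefix p P) (j + 1)) (p + 43))

/-- For each residue `c` modulo `17`, a pair `(p, P)` such that `p` is congruent to `c` and the
`p` lowest digits of `P` form a word that can be prepended to `toeplitz`. -/
def heads : List (ℕ × ℕ) :=
[(17, 103122), (18, 156973), (19, 414505), (20, 627922), (4, 13), (22, 2511570), (23, 6596178),
   (24, 10046765), (8, 217), (9, 434), (27, 80368425), (28, 160617170), (29, 321498326), (13,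
   4905), (14, 9810), (15, 27862), (16, 55597)]

theorem isHeadB_heads : (heads.all fun x => isHeadB x.1 x.2) = true := by
  decide +kernel

theorem exists_isHeadB (c : ℕ) (hc : c < 17) :
    ∃ x ∈ heads, x.1 % 17 = c := by
  revert c
  decide +kernel

theorem not_cubeAt_prepend {p P : ℕ} (h : isHeadB p P = true) (s q : ℕ) :
    ¬ CubeAt (prepend p P) s q := by
  simp only [isHeadB, Bool.and_eq_true, decide_eq_true_eq, List.all_eq_true, List.mem_range,
    Bool.not_eq_true'] at h
  obtain ⟨⟨⟨⟨hp, hp'⟩, hbit⟩, hcube⟩, -⟩ := h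
  rintro ⟨hq, hc⟩
  by_cases hs : p ≤ s
  · refine not_cubeAt_toeplitz (s - p) q ⟨hq, fun i hi => ?_⟩
    have := hc i hi
    rwa [show s + i = p + (s - p + i) by omega, Nat.add_assoc p, prepend_add, prepend_add] at this
  push Not at hs
  by_cases hqp : q < p + 17
  · have := hcube s hs (q - 1) (by omega)
    rw [Nat.sub_add_cancel hq, ← Bool.not_eq_true, cubeAtB_iff hq] at this
    refine this ⟨hq, fun i hi => ?_⟩
    rw [← prepend_eq_testBit (by omega), ← prepend_eq_testBit (by omega)]
    exact hc i hi
  · obtain ⟨k, rfl⟩ := dvd_of_toeplitz_eq (s := 0) (q := q) fun i hi => by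
      have := hc (p - s + i) (by omega)
      rwa [show s + (p - s + i) = p + (0 + i) by omega, Nat.add_assoc p, prepend_add,
        prepend_add] at this
    have := hc (p - 1 - s) (by omega)
    rw [show s + (p - 1 - s) = p - 1 by omega,
      show p - 1 + 17 * k = p + (17 * k - 1) by omega, prepend_add,
      toeplitz_of_mod_ne (by omega), show (17 * k - 1) % 17 = 16 by omega, prepend,
      if_pos (by omega), hbit] at this
    exact absurd this (by decide +kernel)

theorem irreducibleCubeFree_prepend {p P m : ℕ} (h : isHeadB p P = true) (hm : 2 ≤ m) :
    IrreducibleCubeFree (toWord (p + 17 * m + 10) (prepend p P)) := by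
  rw [irreducibleCubeFree_toWord]
  refine ⟨fun s q _ => not_cubeAt_prepend h s q, by omega, fun j hj hjn => ?_⟩
  by_cases hjp : j < p + 17
  · simp only [isHeadB, Bool.and_eq_true, List.all_eq_true, List.mem_range] at h
    have := h.2 (j - 1) (by omega)
    rw [Nat.sub_add_cancel hj, hasCubeB_iff, testBit_eraseBit] at this
    obtain ⟨s, q, -, -, hs, hc⟩ := this
    have := exists_cubeAt_eraseSeq_of_window (f := prepend p P) (k := 0) (l := p + 44)
      (n := p + 17 * m + 10) (fun i hi => by rw [Nat.zero_add, prepend_eq_testBit (by omega)])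
      (by omega) ⟨s, q, hs, hc⟩
    rwa [Nat.zero_add] at this
  · obtain ⟨b, hb, hbj, hjb⟩ : ∃ b, b + 2 ≤ m ∧ p + 17 * b + 17 ≤ j ∧ j < p + 17 * b + 43 :=
      ⟨min ((j - p) / 17 - 1) (m - 2), by omega, by omega, by omega⟩
    have := hasCubeB_threeBlocks (toeplitz b) (toeplitz (b + 1)) (toeplitz (b + 2))
      (j - (p + 17 * b)) (by omega) (by omega)
    rw [hasCubeB_iff, testBit_eraseBit] at this
    obtain ⟨s, q, -, -, hs, hc⟩ := this
    have := exists_cubeAt_eraseSeq_of_window (f := prepend p P) (k := p + 17 * b) (l := 44)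
      (n := p + 17 * m + 10)
      (fun i hi => by rw [Nat.add_assoc, prepend_add, toeplitz_window _ (by omega)])
      (by omega) ⟨s, q, hs, hc⟩
    rwa [show p + 17 * b + (j - (p + 17 * b)) = j by omega] at this

theorem mem_shortWords_or_exists_head (n : ℕ) (hn : 22 ≤ n) (hlt : n < 73) :
    n ∈ shortWords.map Prod.fst ∨ ∃ x ∈ heads, x.1 % 17 = (n + 7) % 17 ∧ x.1 + 44 ≤ n := by
  revert n
  decide +kernel

theorem heads_fst_lt : ∀ x ∈ heads, x.1 < 30 := by
  decide +kernel

theorem exists_of_head {n : ℕ} {x : ℕ × ℕ} (hx : x ∈ heads) (hmod : x.1 % 17 = (n + 7) % 17)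
    (hle : x.1 + 44 ≤ n) : ∃ w : List (Fin 2), w.length = n ∧ IrreducibleCubeFree w := by
  have := irreducibleCubeFree_prepend (m := (n - 10 - x.1) / 17)
    (List.all_eq_true.1 isHeadB_heads x hx) (by omega)
  exact ⟨_, by rw [length_toWord]; omega, this⟩

theorem exists_irreducibleCubeFree {n : ℕ} (hn : 22 ≤ n) :
    ∃ w : List (Fin 2), w.length = n ∧ IrreducibleCubeFree w := by
  by_cases hlt : n < 73
  · rcases mem_shortWords_or_exists_head n hn hlt with h | ⟨x, hx, hmod, hle⟩
    · exact exists_of_mem_shortWords h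
    · exact exists_of_head hx hmod hle
  · obtain ⟨x, hx, hmod⟩ := exists_isHeadB ((n + 7) % 17) (by omega)
    have := heads_fst_lt x hx
    exact exists_of_head hx hmod (by omega)

end IrreducibleCubeFreeLengths

open IrreducibleCubeFreeLengths in
theorem irreducible_cubeFree_lengths (n : ℕ) :
    (∃ w : List (Fin 2), w.length = n ∧ IrreducibleCubeFree w) ↔
      (n = 10 ∨ n = 14 ∨ n = 18 ∨ n = 19 ∨ n = 20 ∨ 22 ≤ n) := by
  constructor
  · rintro ⟨w, rfl, hw⟩
    by_cases hlt : w.length < 22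
    · have := isExceptional_of_irreducibleCubeFree hw hlt
      simp only [isExceptional, Bool.or_eq_true, beq_iff_eq] at this
      omega
    · omega
  · rintro (rfl | rfl | rfl | rfl | rfl | hn)
    iterate 5 exact exists_of_mem_shortWords (by decide +kernel)
    exact exists_irreducibleCubeFree hn
end

section
/- There exists a delicate squarefree ternary word of length n if and only if n = 5 or n ≥ 7. -/
/-- A square is a word of the form XX with X nonempty. -/
def IsSquare' {α : Type*} (w : List α) : Prop :=
  ∃ X : List α, X ≠ [] ∧ w = X ++ X

/-- A word contains a square if some factor (contiguous subword) of it is a square. -/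
def HasSquare {α : Type*} (w : List α) : Prop :=
  ∃ u, u <:+: w ∧ IsSquare' u

/-- A word is squarefree if none of its factors is a square. -/
def SquareFree' {α : Type*} (w : List α) : Prop := ¬ HasSquare w

/-- A delicate squarefree ternary word: a nonempty squarefree word over {0,1,2}
such that changing any one of its letters to a different letter creates a square. -/
def DelicateSquareFree (w : List (Fin 3)) : Prop :=
  w ≠ [] ∧ SquareFree' w ∧
    ∀ (i : ℕ) (h : i < w.length) (a : Fin 3), a ≠ w.get ⟨i, h⟩ → HasSquare (w.set i a)

theorem hasSquare_iff {α : Type*} (w : List α) :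
    HasSquare w ↔ ∃ i < w.length, ∃ p < w.length, 0 < p ∧ i + 2 * p ≤ w.length ∧
      ∀ k < p, w[i + k]? = w[i + p + k]? := by
  constructor
  · rintro ⟨_, ⟨s, t, rfl⟩, X, hX, rfl⟩
    have hpos := List.length_pos_iff.2 hX
    refine ⟨s.length, ?_, X.length, ?_, hpos, ?_, fun k hk => ?_⟩
    any_goals simp only [List.length_append]; omega
    simp only [List.append_assoc, Nat.add_assoc, List.getElem?_append_right (Nat.le_add_right _ _),
      Nat.add_sub_cancel_left, List.getElem?_append_left hk]
  · rintro ⟨i, -, p, -, hp, hi, h⟩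
    refine ⟨(w.drop i).take (p + p),
      (List.take_prefix _ _).isInfix.trans (List.drop_suffix _ _).isInfix,
      (w.drop i).take p, ?_, ?_⟩
    · rw [← List.length_pos_iff, List.length_take, List.length_drop]
      omega
    · rw [List.take_add, List.drop_drop]
      congr 1
      refine List.ext_getElem? fun k => ?_
      by_cases hk : k < p
      · simp only [List.getElem?_take, List.getElem?_drop, hk, if_true, h k hk]
      · simp [hk]

instance (w : List (Fin 3)) : Decidable (HasSquare w) :=
  decidable_of_iff _ (hasSquare_iff w).symm

instance (w : List (Fin 3)) : Decidable (SquareFree' w) :=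
  inferInstanceAs (Decidable (¬ HasSquare w))

instance (w : List (Fin 3)) : Decidable (DelicateSquareFree w) :=
  inferInstanceAs (Decidable (_ ∧ _ ∧ _))

theorem not_delicateSquareFree_of_length (w : List (Fin 3)) (h : w.length < 5 ∨ w.length = 6) :
    ¬ DelicateSquareFree w := by
  match w, h with
  | [], _ => decide
  | [a], _ => revert a; decide +kernel
  | [a, b], _ => revert a b; decide +kernel
  | [a, b, c], _ => revert a b c; decide +kernel
  | [a, b, c, d], _ => revert a b c d; decide +kernel
  | [a, b, c, d, e, f], _ => revert a b c d e f; decide +kernel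
  | [_, _, _, _, _], h => simp at h
  | _ :: _ :: _ :: _ :: _ :: _ :: _ :: _, h => simp at h; omega

/-- An infinite word is squarefree if it has no two equal adjacent factors. -/
def SquareFreeSeq {α : Type*} (f : ℕ → α) : Prop :=
  ∀ p, 0 < p → ∀ i, ∃ k < p, f (i + k) ≠ f (i + p + k)

theorem SquareFreeSeq.shift {α : Type*} {f : ℕ → α} (hf : SquareFreeSeq f) (a : ℕ) :
    SquareFreeSeq fun k => f (a + k) := fun p hp i => by
  simpa only [Nat.add_assoc] using hf p hp (a + i)

theorem SquareFreeSeq.squareFree {α : Type*} {f : ℕ → α} (hf : SquareFreeSeq f) (n : ℕ) :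
    SquareFree' ((List.range n).map f) := by
  rw [SquareFree', hasSquare_iff]
  rintro ⟨i, -, p, -, hp, hi, h⟩
  obtain ⟨k, hk, hne⟩ := hf p hp i
  rw [List.length_map, List.length_range] at hi
  have := h k hk
  rw [List.getElem?_map, List.getElem?_map, List.getElem?_range (by omega),
    List.getElem?_range (by omega)] at this
  exact hne (Option.some.inj this)

theorem hasSquare_set {f : ℕ → Fin 3} {n x : ℕ} {c : Fin 3} (i p : ℕ) (hp : 0 < p)
    (hi : i + 2 * p ≤ n)
    (h : ∀ k < p, Function.update f x c (i + k) = Function.update f x c (i + p + k)) :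
    HasSquare (((List.range n).map f).set x c) := by
  have key : ((List.range n).map f).set x c = (List.range n).map (Function.update f x c) := by
    refine List.ext_getElem (by simp) fun j h₁ h₂ => ?_
    simp [List.getElem_set, Function.update_apply, eq_comm]
  rw [key, hasSquare_iff]
  simp only [List.length_map, List.length_range]
  refine ⟨i, by omega, p, by omega, hp, hi, fun k hk => ?_⟩
  rw [List.getElem?_map, List.getElem?_map, List.getElem?_range (by omega),
    List.getElem?_range (by omega)]
  exact congrArg some (h k hk)

theorem eq_of_ne_of_ne : ∀ {a b c d : Fin 3}, a ≠ b → c ≠ a → c ≠ b → d ≠ a → d ≠ b → c = d := by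
  decide

/-- The prefix of length `n` of a squarefree ternary sequence is delicate when changing the first
letter of its prefix of length `2 * q`, or the last letter of its suffix of length `4`, can produce
a square. -/
theorem SquareFreeSeq.delicateSquareFree {f : ℕ → Fin 3} (hf : SquareFreeSeq f) {n q : ℕ}
    (hq : 2 ≤ q) (hqn : 2 * q ≤ n)
    (hstart : ∀ k, 0 < k → k < q → f k = f (q + k))
    (hend : f (n - 2) = f (n - 4)) :
    DelicateSquareFree ((List.range n).map f) := by
  have hne : ∀ i, f i ≠ f (i + 1) := fun i => by
    obtain ⟨k, hk, h⟩ := hf 1 one_pos i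
    obtain rfl : k = 0 := by omega
    exact h
  have hne₂ : ∀ i, f (i + 1) = f (i + 3) → f i ≠ f (i + 2) := fun i h h' => by
    obtain ⟨k, hk, h''⟩ := hf 2 two_pos i
    interval_cases k
    exacts [h'' h', h'' h]
  refine ⟨?_, hf.squareFree n, fun x hx c hc => ?_⟩
  · rw [← List.length_pos_iff, List.length_map, List.length_range]
    omega
  simp only [List.length_map, List.length_range] at hx
  simp only [List.get_eq_getElem, List.getElem_map, List.getElem_range] at hc
  by_cases hcr : x + 1 < n ∧ c = f (x + 1)
  · refine hasSquare_set x 1 one_pos (by omega) fun k hk => ?_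
    obtain rfl : k = 0 := by omega
    simp [hcr.2]
  by_cases hcl : 0 < x ∧ c = f (x - 1)
  · obtain ⟨y, rfl⟩ : ∃ y, x = y + 1 := ⟨x - 1, by omega⟩
    refine hasSquare_set y 1 one_pos (by omega) fun k hk => ?_
    obtain rfl : k = 0 := by omega
    simp_all
  rcases Nat.eq_zero_or_pos x with rfl | hx0
  · have h1 : c ≠ f 1 := fun h => hcr ⟨by omega, h⟩
    have hcq : c = f q := by
      refine eq_of_ne_of_ne (hne 0) hc h1 (fun h => ?_) fun h => hne q ?_
      · obtain ⟨k, hk, h'⟩ := hf q (by omega) 0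
        rcases Nat.eq_zero_or_pos k with rfl | hk0
        · simp [h] at h'
        · exact h' (by simpa using hstart k hk0 hk)
      · rw [h, hstart 1 one_pos (by omega)]
    refine hasSquare_set 0 q (by omega) (by omega) fun k hk => ?_
    rcases Nat.eq_zero_or_pos k with rfl | hk0
    · simp [Function.update_apply, hcq]
    · have h1 : 0 + k ≠ 0 := by omega
      have h2 : 0 + q + k ≠ 0 := by omega
      rw [Function.update_of_ne h1, Function.update_of_ne h2, Nat.zero_add, Nat.zero_add,
        hstart k hk0 hk]
  have hl : c ≠ f (x - 1) := fun h => hcl ⟨hx0, h⟩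
  rcases Nat.lt_or_ge (x + 1) n with hxn | hxn
  · have hr : c ≠ f (x + 1) := fun h => hcr ⟨hxn, h⟩
    rcases Nat.lt_or_ge x 2 with hx2 | hx2
    · obtain rfl : x = 1 := by omega
      have h02 : f 0 = f 2 := eq_of_ne_of_ne (Ne.symm hc) (hne 0) hl.symm (hne 1).symm hr.symm
      have h3 : c = f 3 := eq_of_ne_of_ne (hne 1) hc hr (fun h => hne₂ 0 h.symm h02) (hne 2).symm
      refine hasSquare_set 0 2 two_pos (by omega) fun k hk => ?_
      interval_cases k <;> simp [h02, h3]
    · obtain ⟨y, rfl⟩ : ∃ y, x = y + 2 := ⟨x - 2, by omega⟩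
      have h13 : f (y + 1) = f (y + 3) :=
        eq_of_ne_of_ne (Ne.symm hc) (hne (y + 1)) hl.symm (hne (y + 2)).symm hr.symm
      have h0 : c = f y :=
        eq_of_ne_of_ne (hne (y + 1)) hl hc (hne y) (hne₂ y h13)
      refine hasSquare_set y 2 two_pos (by omega) fun k hk => ?_
      interval_cases k <;> simp [h13, h0]
  · obtain ⟨y, rfl⟩ : ∃ y, x = y + 3 := ⟨x - 3, by omega⟩
    obtain rfl : n = y + 4 := by omega
    have h0 : f y = f (y + 2) := hend.symm
    have h1 : c = f (y + 1) :=
      eq_of_ne_of_ne (hne (y + 2)) hl hc (hne (y + 1)) (fun h => hne₂ y h h0)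
    refine hasSquare_set y 2 two_pos (by omega) fun k hk => ?_
    interval_cases k <;> simp [h0, h1]

/-- The image of `0` under the `18`-uniform squarefree morphism generating `morphicWord`. -/
def block (r : ℕ) : Fin 3 :=
  [0, 1, 2, 0, 2, 1, 0, 2, 0, 1, 0, 2, 1, 2, 0, 2, 1, 0].getD r 0

/-- The fixed point of the morphism sending each letter `a` to `block` shifted by `a`. -/
def morphicWord (n : ℕ) : Fin 3 :=
  if n < 18 then block n else block (n % 18) + morphicWord (n / 18)
termination_by n

theorem morphicWord_eq (n : ℕ) : morphicWord n = block (n % 18) + morphicWord (n / 18) := by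
  rcases Nat.lt_or_ge n 18 with h | h
  · have h0 : morphicWord 0 = 0 := by rw [morphicWord]; rfl
    rw [Nat.div_eq_of_lt h, Nat.mod_eq_of_lt h, h0, add_zero, morphicWord, if_pos h]
  · rw [morphicWord, if_neg (by omega)]

theorem morphicWord_eq_of_block {i j : ℕ} (h : i / 18 = j / 18)
    (hb : block (i % 18) = block (j % 18)) : morphicWord i = morphicWord j := by
  rw [morphicWord_eq i, morphicWord_eq j, h, hb]

theorem morphicWord_ne_succ (i : ℕ) : morphicWord i ≠ morphicWord (i + 1) := by
  induction i using Nat.strong_induction_on with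
  | _ i ih =>
    rw [morphicWord_eq i, morphicWord_eq (i + 1)]
    rcases Nat.lt_or_ge (i % 18) 17 with h | h
    · have h1 : (i + 1) / 18 = i / 18 := by omega
      have h2 : (i + 1) % 18 = i % 18 + 1 := by omega
      rw [h1, h2, Ne, add_left_inj]
      generalize i % 18 = r at h
      revert r
      decide
    · have h1 : (i + 1) / 18 = i / 18 + 1 := by omega
      have h2 : (i + 1) % 18 = 0 := by omega
      have h3 : i % 18 = 17 := by omega
      rw [h1, h2, h3]
      have := ih (i / 18) (by omega)
      simpa [block] using this

theorem block_short_squareFree : ∀ a b c : Fin 3, a ≠ b → b ≠ c → ∀ r < 18, ∀ p < 18, 0 < p →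
    ∃ k < p, block ((r + k) % 18) + [a, b, c].getD ((r + k) / 18) 0 ≠
      block ((r + p + k) % 18) + [a, b, c].getD ((r + p + k) / 18) 0 := by
  decide +kernel

theorem block_synchronizing : ∀ s < 18, 0 < s → ∃ x < 17, (x + s) % 18 < 17 ∧
    block (x + 1) - block x ≠ block ((x + s) % 18 + 1) - block ((x + s) % 18) := by
  decide +kernel

theorem morphicWord_succ_sub {i : ℕ} (h : i % 18 < 17) :
    morphicWord (i + 1) - morphicWord i = block (i % 18 + 1) - block (i % 18) := by
  have h1 : (i + 1) / 18 = i / 18 := by omega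
  have h2 : (i + 1) % 18 = i % 18 + 1 := by omega
  rw [morphicWord_eq i, morphicWord_eq (i + 1), h1, h2, add_sub_add_right_eq_sub]

theorem squareFreeSeq_morphicWord : SquareFreeSeq morphicWord := by
  intro p
  induction p using Nat.strong_induction_on with
  | _ p ih =>
  intro hp i
  by_contra! h
  rcases Nat.eq_zero_or_pos (p % 18) with hs | hs
  · obtain ⟨q, rfl⟩ : ∃ q, p = 18 * q := ⟨p / 18, by omega⟩
    obtain ⟨j, hj, hne⟩ := ih q (by omega) (by omega) (i / 18)
    have := h (18 * j) (by omega)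
    have h1 : (i + 18 * j) / 18 = i / 18 + j := by omega
    have h2 : (i + 18 * q + 18 * j) / 18 = i / 18 + q + j := by omega
    have h3 : (i + 18 * j) % 18 = i % 18 := by omega
    have h4 : (i + 18 * q + 18 * j) % 18 = i % 18 := by omega
    rw [morphicWord_eq, morphicWord_eq (i + 18 * q + 18 * j), h1, h2, h3, h4] at this
    exact hne (add_left_cancel this)
  rcases Nat.lt_or_ge p 18 with hp18 | hp18
  · obtain ⟨k, hk, hne⟩ := block_short_squareFree (morphicWord (i / 18)) (morphicWord (i / 18 + 1))
      (morphicWord (i / 18 + 2)) (morphicWord_ne_succ _) (morphicWord_ne_succ _) (i % 18)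
      (Nat.mod_lt _ (by norm_num)) p hp18 hp
    have hval : ∀ t < 54, morphicWord (18 * (i / 18) + t) = block (t % 18) +
        [morphicWord (i / 18), morphicWord (i / 18 + 1), morphicWord (i / 18 + 2)].getD
          (t / 18) 0 := fun t ht => by
      have h1 : (18 * (i / 18) + t) / 18 = i / 18 + t / 18 := by omega
      have h2 : (18 * (i / 18) + t) % 18 = t % 18 := by omega
      have h3 : t / 18 < 3 := by omega
      rw [morphicWord_eq, h1, h2]
      generalize t / 18 = e at h3
      interval_cases e <;> rfl
    rw [← hval _ (by omega), ← hval _ (by omega)] at hne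
    apply hne
    convert h k hk using 2 <;> omega
  · obtain ⟨x, hx, hxs, hne⟩ := block_synchronizing (p % 18) (Nat.mod_lt _ (by norm_num)) hs
    obtain ⟨k, hk, hkx⟩ : ∃ k < 18, (i + k) % 18 = x := ⟨(x + 18 - i % 18) % 18, by omega, by omega⟩
    have hy : (i + p + k) % 18 = (x + p % 18) % 18 := by omega
    rw [← hy, ← hkx] at hne
    rw [← hy] at hxs
    rw [← morphicWord_succ_sub (by omega), ← morphicWord_succ_sub hxs, h k (by omega)] at hne
    exact hne (congrArg (· - _) (h (k + 1) (by omega)))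

/-- For every residue `d` of the distance between the two ends, `block` contains a pattern making
the first letter delicate and a pattern making the last letter delicate. -/
theorem exists_block_patterns : ∀ d < 18, ∃ i < 18, ∃ q < 5, 2 ≤ q ∧
    (2 * q ≤ d + 1 ∨ d < 4 ∨ d = 5) ∧ i + 2 * q ≤ 18 ∧
    (∀ k < q, 0 < k → block (i + k) = block (i + q + k)) ∧
    2 ≤ (i + d + 17) % 18 ∧ block ((i + d + 17) % 18) = block ((i + d + 17) % 18 - 2) := by
  decide +kernel

theorem exists_delicateSquareFree {n : ℕ} (hn : n = 5 ∨ 7 ≤ n) :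
    ∃ w : List (Fin 3), w.length = n ∧ DelicateSquareFree w := by
  obtain ⟨i, hi, q, hq5, hq, hqd, hiq, hstart, hs, hend⟩ :=
    exists_block_patterns ((n - 1) % 18) (Nat.mod_lt _ (by norm_num))
  refine ⟨_, by simp, (squareFreeSeq_morphicWord.shift i).delicateSquareFree (n := n) hq (by omega)
    (fun k hk0 hk => ?_) ?_⟩
  · refine morphicWord_eq_of_block (by omega) ?_
    rw [Nat.mod_eq_of_lt (by omega), Nat.mod_eq_of_lt (by omega), ← Nat.add_assoc]
    exact hstart k hk hk0
  · refine morphicWord_eq_of_block (by omega) ?_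
    convert hend using 2 <;> omega

theorem delicate_squareFree_lengths (n : ℕ) :
    (∃ w : List (Fin 3), w.length = n ∧ DelicateSquareFree w) ↔ (n = 5 ∨ 7 ≤ n) := by
  refine ⟨?_, exists_delicateSquareFree⟩
  rintro ⟨w, rfl, hw⟩
  by_contra h
  exact not_delicateSquareFree_of_length w (by omega) hw
end

section
/- A binary morphism preserves cubefreeness if and only if the images of all cubefree binary words of length 7 are cubefree; that is, for a monoid morphism f from binary words to binary words, f(w) is cubefree for every cubefree word w if and only if f(u) is cubefree for every cubefree word u of length 7. -/
section Words

variable {α : Type*}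

theorem CubeFree.eq_nil {w l t r : List α} (hw : CubeFree w) (h : w = l ++ (t ++ t ++ t) ++ r) :
    t = [] := by
  by_contra ht
  exact hw ⟨t ++ t ++ t, ⟨l, r, h.symm⟩, t, ht, rfl⟩

theorem HasCube.mono {u w : List α} (hu : HasCube u) (h : u <:+: w) : HasCube w := by
  obtain ⟨v, hv, hc⟩ := hu
  exact ⟨v, hv.trans h, hc⟩

theorem CubeFree.mono {u w : List α} (hw : CubeFree w) (h : u <:+: w) : CubeFree u :=
  fun hu => hw (hu.mono h)

theorem HasCube.reverse {w : List α} (hw : HasCube w) : HasCube w.reverse := by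
  obtain ⟨_, hv, X, hX, rfl⟩ := hw
  exact ⟨_, List.reverse_infix.2 hv, X.reverse, by simpa using hX, by simp⟩

theorem CubeFree.reverse {w : List α} (hw : CubeFree w) : CubeFree w.reverse :=
  fun h => hw (by simpa using h.reverse)

theorem hasCube_of_comm {x y : List α} (h : x ++ y = y ++ x) (hx : x ≠ []) (hy : y ≠ []) :
    HasCube (x ++ y ++ x) := by
  rcases List.append_eq_append_iff.1 h with ⟨z, rfl, h2⟩ | ⟨z, rfl, h2⟩
  · refine ⟨_, ⟨[], z, ?_⟩, x, hx, rfl⟩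
    simp [← h2]
  · refine ⟨_, ⟨[], z ++ z, ?_⟩, y, hy, rfl⟩
    have h3 : ∀ r, z ++ (y ++ r) = y ++ (z ++ r) := fun r => by
      rw [← List.append_assoc, ← h2, List.append_assoc]
    simp [h3]

theorem CubeFree.eq_nil_of_comm {w l x y r : List α} (hw : CubeFree w)
    (h : w = l ++ (x ++ y ++ x) ++ r) (hxy : x ++ y = y ++ x) : x = [] ∨ y = [] := by
  by_contra! hne
  exact hw ((hasCube_of_comm hxy hne.1 hne.2).mono ⟨l, r, h.symm⟩)

/-- A word whose square is cubefree is primitive: it occurs in its square only trivially. -/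
theorem CubeFree.eq_nil_of_sq {B l r : List α} (hB : CubeFree (B ++ B))
    (h : B ++ B = l ++ B ++ r) : l = [] ∨ r = [] := by
  have hl : l.length + r.length = B.length := by
    have := congrArg List.length h; simp at this; omega
  obtain ⟨m, rfl⟩ : ∃ m, B = l ++ m := by
    rcases List.append_eq_append_iff.1 (h.trans (List.append_assoc l B r)) with
      ⟨z, h1, h2⟩ | ⟨z, h1, h2⟩
    · have := congrArg List.length h1
      simp at this
      have hz : z = [] := List.length_eq_zero_iff.1 (by omega)
      exact ⟨[], by simp [h1, hz]⟩
    · exact ⟨z, h1⟩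
  have h1 : (m ++ l) ++ m = (l ++ m) ++ r := by simpa using h
  obtain ⟨h2, rfl⟩ := List.append_inj h1 (by simp; omega)
  refine hB.eq_nil_of_comm (l := []) (r := m) (by simp) h2.symm

/-- If `X = s ++ t = t ++ p`, `Y` starts with `p` and ends with `s`, then `Y ++ X ++ Y` has the
cube of `s`. -/
theorem CubeFree.eq_nil_of_conj {X Y s t p y z : List α} (h : CubeFree (Y ++ X ++ Y))
    (h1 : X = s ++ t) (h2 : X = t ++ p) (h3 : Y = p ++ y) (h4 : Y = z ++ s) : s = [] := by
  refine h.eq_nil (l := z) (r := t ++ y) ?_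
  conv_lhs => rw [h1]; arg 1; rw [h4]
  have : t ++ p = s ++ t := h2.symm.trans h1
  rw [h3]
  simp only [List.append_assoc]
  rw [← List.append_assoc t p y, this]
  simp

theorem cover_aab_bb {A B s s' p' p : List α} (hle : A.length ≤ B.length) (hs' : s' ≠ [])
    (hp' : p' ≠ [])
    (hAB : CubeFree (A ++ B)) (hBA : CubeFree (B ++ A)) (hA : A = s' ++ p') (h1 : B = s ++ s')
    (h2 : s <:+ A) (h3 : B = p' ++ p) (h4 : p <+: B) : False := by
  obtain ⟨q, rfl⟩ : ∃ q, p' = p ++ q := by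
    have h5 : p' <+: B := ⟨p, h3.symm⟩
    rcases List.prefix_or_prefix_of_prefix h4 h5 with ⟨q, hq⟩ | ⟨q, rfl⟩
    · exact ⟨q, hq.symm⟩
    · refine absurd (hAB.eq_nil (l := s') (t := p') (r := q) ?_) hp'
      rw [hA, h3]; simp
  have e1 := congrArg List.length hA
  have e2 := congrArg List.length h1
  have e3 := congrArg List.length h3
  simp only [List.length_append] at e1 e2 e3
  obtain ⟨x, rfl⟩ : ∃ x, s = x ++ (p ++ q) := by
    obtain ⟨x, hx⟩ := List.suffix_of_suffix_length_le (l₁ := p ++ q) ⟨s', hA.symm⟩ h2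
      (by simp; omega)
    exact ⟨x, hx.symm⟩
  simp only [List.length_append] at e2
  have h6 : x ++ (p ++ q ++ s') = p ++ (q ++ p) := by
    simpa using h1.symm.trans h3
  obtain ⟨z, rfl⟩ : ∃ z, p = x ++ z := by
    rcases List.append_eq_append_iff.1 h6 with ⟨z, h, -⟩ | ⟨z, h, -⟩
    · exact ⟨z, h⟩
    · have := congrArg List.length h
      simp at this
      have hz : z = [] := List.length_eq_zero_iff.1 (by omega)
      exact ⟨[], by simp [h, hz]⟩
  simp only [List.length_append] at e1 e2 e3
  have h7 : z = s' := by
    have : (x ++ (x ++ z ++ q)) ++ s' = (x ++ z ++ q ++ x) ++ z := by simpa using h6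
    exact (List.append_inj_right' this (by omega)).symm
  subst h7
  have h8 : x ++ (z ++ q) = z ++ q ++ x := by
    have : (x ++ (z ++ q)) ++ z = (z ++ q ++ x) ++ z := by simpa using h6
    exact List.append_cancel_right this
  rcases hBA.eq_nil_of_comm (l := []) (x := x) (y := z ++ q) (r := z ++ A) (by rw [h3]; simp) h8
    with rfl | h
  · refine hs' (hBA.eq_nil (l := z ++ q) (r := q) ?_)
    rw [h3, hA]; simp
  · exact hs' (by simpa using (List.append_eq_nil_iff.1 h).1)

theorem cover_baa_bb {A B s s' p' p : List α} (hle : A.length ≤ B.length) (hs' : s' ≠ [])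
    (hp' : p' ≠ [])
    (hAB : CubeFree (A ++ B)) (hBA : CubeFree (B ++ A)) (hA : A = s' ++ p') (h1 : B = p' ++ p)
    (h2 : p <+: A) (h3 : B = s ++ s') (h4 : s <:+ B) : False := by
  refine cover_aab_bb (A := A.reverse) (B := B.reverse) (s := p.reverse) (s' := p'.reverse)
    (p := s.reverse) (p' := s'.reverse) (by simpa) (by simpa) (by simpa)
    (by simpa using hBA.reverse) (by simpa using hAB.reverse) (by simp [hA]) (by simp [h1])
    (by simpa) (by simp [h3]) (by simpa)

theorem cover_bab_bb {A B s s' p' p : List α} (hle : A.length ≤ B.length) (hs' : s' ≠ [])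
    (hp' : p' ≠ [])
    (hAB : CubeFree (A ++ B)) (hBA : CubeFree (B ++ A)) (hA : A = s' ++ p') (h1 : B = p' ++ p)
    (h2 : p <+: B) (h3 : B = s ++ s') (h4 : s <:+ B) : False := by
  have l1 : p.length < p'.length := by
    by_contra! hl
    obtain ⟨q, rfl⟩ := List.prefix_of_prefix_length_le (l₁ := p') ⟨p, h1.symm⟩ h2 hl
    refine hp' (hAB.eq_nil (l := s') (r := q) ?_)
    rw [hA, h1]; simp
  have l2 : s.length < s'.length := by
    by_contra! hl
    obtain ⟨q, rfl⟩ := List.suffix_of_suffix_length_le (l₁ := s') ⟨s, h3.symm⟩ h4 hl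
    refine hs' (hBA.eq_nil (l := q) (r := p') ?_)
    rw [hA, h3]; simp
  have e1 := congrArg List.length hA
  have e2 := congrArg List.length h1
  have e3 := congrArg List.length h3
  simp only [List.length_append] at e1 e2 e3
  omega

theorem cover_baab_bb {A B s s' p' p : List α} (hp' : p' ≠ [])
    (hAB : CubeFree (A ++ B)) (hA : A = s' ++ p') (h1 : B = s ++ s')
    (h2 : s <:+ B) (h3 : B = p' ++ (A ++ p)) : False := by
  have e1 := congrArg List.length hA
  have e2 := congrArg List.length h1
  have e3 := congrArg List.length h3
  simp only [List.length_append] at e1 e2 e3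
  obtain ⟨k, rfl⟩ := List.suffix_of_suffix_length_le (l₁ := p' ++ p)
    ⟨p' ++ s', by rw [h3, hA]; simp⟩ h2 (by simp; omega)
  simp only [List.length_append] at e2
  obtain rfl : k = p' := by
    refine List.append_inj_left (t₁ := p' ++ p ++ s') (t₂ := A ++ p) ?_ (by omega)
    rw [← h3, h1]; simp
  refine hp' (hAB.eq_nil (l := s') (r := p ++ s') ?_)
  rw [hA, h1]; simp

theorem cover_baab_bb' {A B s s' p' p : List α} (hs' : s' ≠ [])
    (hBA : CubeFree (B ++ A)) (hA : A = s' ++ p') (h1 : B = p' ++ p)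
    (h2 : p <+: B) (h3 : B = s ++ (A ++ s')) : False := by
  refine cover_baab_bb (A := A.reverse) (B := B.reverse) (s := p.reverse) (s' := p'.reverse)
    (p := s.reverse) (p' := s'.reverse) (by simpa)
    (by simpa using hBA.reverse) (by simp [hA]) (by simp [h1]) (by simpa) ?_
  conv_lhs => rw [h3]
  simp

theorem append_eq_extend {u v : List α} (h : u = v) (r : List α) : u ++ r = v ++ r := by rw [h]

theorem cover_baa_ab {A B c p' p : List α} (hp' : p' ≠ []) (hp : p ≠ [])
    (hBAB : CubeFree (B ++ A ++ B)) (hBAA : CubeFree (B ++ A ++ A))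
    (hABAA : CubeFree (A ++ B ++ A ++ A)) (h1 : B = c ++ A ++ p') (h2 : B = p' ++ A ++ p)
    (h3 : p <+: A) : False := by
  have hB : CubeFree B := hBAB.mono ⟨[], A ++ B, by simp⟩
  have heq : c = p' → False := by
    rintro rfl
    refine hp' ((List.append_eq_nil_iff.1
      (hBAB.eq_nil (l := []) (t := c ++ A) (r := p) ?_)).1)
    conv_lhs => arg 1; rw [h1]
    rw [h2]; simp
  obtain ⟨y, hy⟩ := h3
  have h4 : c ++ (A ++ p') = p' ++ (A ++ p) := by simpa using h1.symm.trans h2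
  rcases List.append_eq_append_iff.1 h4 with ⟨b, rfl, h5⟩ | ⟨b, rfl, h5⟩
  · rcases List.append_eq_append_iff.1 h5 with ⟨d, rfl, h6⟩ | ⟨e, rfl, h6⟩
    · have E := append_eq_extend h6
      simp only [List.append_assoc] at E
      refine hp (List.append_eq_nil_iff.1
        (hBAA.eq_nil (l := d) (t := A ++ p) (r := y) ?_)).2
      rw [h2]
      simp only [List.append_assoc, E, hy]
    · rcases List.append_eq_append_iff.1 ((List.append_assoc ..).symm.trans h6) with
        ⟨e, rfl, h7⟩ | ⟨d, rfl, h7⟩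
      · obtain rfl := hB.eq_nil (l := c) (t := b) (r := e ++ p) (by rw [h2]; simp)
        simp at heq
      · have E := append_eq_extend h7
        simp only [List.append_assoc] at E
        refine hp (List.append_eq_nil_iff.1
          (hABAA.eq_nil (l := e ++ d) (t := e ++ d ++ e ++ p) (r := y) ?_)).2
        rw [h2]
        simp only [List.append_assoc] at hy
        simp only [List.append_assoc, E, hy]
  · rcases List.append_eq_append_iff.1 h5 with ⟨d, rfl, h6⟩ | ⟨e, rfl, h6⟩
    · have e1 := congrArg List.length h6
      have e2 := congrArg List.length hy
      simp only [List.length_append] at e1 e2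
      exact hp' (List.length_eq_zero_iff.1 (by omega))
    · rcases List.append_eq_append_iff.1 ((List.append_assoc ..).symm.trans h6) with
        ⟨e, rfl, h7⟩ | ⟨d, rfl, h7⟩
      · obtain rfl := hB.eq_nil (l := p') (t := b) (r := e ++ p') (by rw [h1]; simp)
        simp at heq
      · subst h7
        have hde : d ++ e = e ++ d := by
          refine List.append_inj_left (t₁ := p' ++ y) (t₂ := e) (by simpa using hy) ?_
          simp [Nat.add_comm]
        rcases hB.eq_nil_of_comm (l := p') (x := e) (y := d) (r := d ++ (e ++ p'))
          (by rw [h2]) hde.symm with rfl | rfl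
        · simp [hp'] at hy
        · obtain rfl := hB.eq_nil (l := p') (t := e) (r := p') (by rw [h1]; simp)
          simp [hp'] at hy

theorem cover_bab_ab {A B c p' p : List α} (hc : c ≠ []) (hp' : p' ≠ [])
    (hBAB : CubeFree (B ++ A ++ B)) (h1 : B = c ++ A ++ p') (h2 : B = p' ++ A ++ p)
    (h3 : p <+: B) : False := by
  have heq : c = p' → False := by
    rintro rfl
    refine hp' ((List.append_eq_nil_iff.1
      (hBAB.eq_nil (l := []) (t := c ++ A) (r := p) ?_)).1)
    conv_lhs => arg 1; rw [h1]
    rw [h2]; simp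
  obtain rfl : p = c := by
    obtain ⟨z, hz⟩ := h3
    have e1 := congrArg List.length h1
    have e2 := congrArg List.length h2
    simp only [List.length_append] at e1 e2
    refine List.append_inj_left (t₁ := z) (t₂ := A ++ p') ?_ (by omega)
    rw [hz]; simp [h1]
  have h4 : p ++ (A ++ p') = p' ++ (A ++ p) := by simpa using h1.symm.trans h2
  rcases List.append_eq_append_iff.1 h4 with ⟨b, rfl, h5⟩ | ⟨b, rfl, h5⟩
  · rcases hBAB.eq_nil_of_comm (l := p) (x := A ++ p) (y := b) (r := b ++ A ++ p)
      (by conv_lhs => arg 1; rw [h1]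
          rw [h2]; simp) (by simpa using h5) with h | rfl
    · exact hc (List.append_eq_nil_iff.1 h).2
    · simp at heq
  · have E := append_eq_extend h5
    simp only [List.append_assoc] at E
    rcases hBAB.eq_nil_of_comm (l := p') (x := A ++ p') (y := b) (r := A ++ (p' ++ b))
      (by conv_lhs => arg 1; rw [h1]
          rw [h2]; simp [E]) (by simpa using h5) with h | rfl
    · exact hp' (List.append_eq_nil_iff.1 h).2
    · simp at heq

theorem cover_baab_ab {A B c p' p : List α} (hp' : p' ≠ []) (hp : p ≠ [])
    (hBAAB : CubeFree (B ++ A ++ A ++ B)) (hABAAB : CubeFree (A ++ B ++ A ++ A ++ B))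
    (h1 : B = c ++ A ++ p') (h2 : B = p' ++ A ++ A ++ p) (h3 : p <+: B) : False := by
  have hB : CubeFree B := hBAAB.mono ⟨[], A ++ A ++ B, by simp⟩
  obtain ⟨z, hz⟩ := h3
  have hAAp : B = A ++ p ++ A ++ A ++ p → False := by
    intro h
    refine hp (List.append_eq_nil_iff.1
      (hABAAB.eq_nil (l := []) (t := A ++ A ++ p) (r := z) ?_)).2
    rw [← hz] at h ⊢
    conv_lhs => arg 1; rw [h]
    simp
  have hpAA : B = p ++ A ++ A ++ p → False := by
    intro h
    refine hp (List.append_eq_nil_iff.1 (List.append_eq_nil_iff.1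
      (hBAAB.eq_nil (l := []) (t := p ++ A ++ A) (r := p) ?_)).1).1
    rw [h]
    simp
  have h4 : c ++ (A ++ p') = p' ++ (A ++ (A ++ p)) := by simpa using h1.symm.trans h2
  rcases List.append_eq_append_iff.1 h4 with ⟨b, rfl, h5⟩ | ⟨b, rfl, h5⟩
  · rcases List.append_eq_append_iff.1 h5 with ⟨d, rfl, h6⟩ | ⟨e, rfl, h6⟩
    · have E := append_eq_extend h6
      simp only [List.append_assoc] at E
      refine hp (List.append_eq_nil_iff.1
        (hBAAB.eq_nil (l := d) (t := A ++ A ++ p) (r := z) ?_)).2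
      conv_lhs => arg 1; rw [h2]
      rw [← hz]
      simp only [List.append_assoc, E]
    · have h6' : b ++ (e ++ (b ++ e ++ p)) = e ++ (c ++ b) := by simpa using h6
      rcases List.append_eq_append_iff.1 h6' with ⟨e, rfl, h7⟩ | ⟨d, rfl, h7⟩
      · obtain rfl := hB.eq_nil (l := c) (t := b) (r := e ++ (b ++ (b ++ e)) ++ p)
          (by rw [h2]; simp)
        refine hAAp ?_
        rw [h2]
        have h8 : c = e ++ p := by simpa using h7.symm
        simp [h8]
      · have E := append_eq_extend h7
        simp only [List.append_assoc] at E
        refine hp (List.append_eq_nil_iff.1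
          (hABAAB.eq_nil (l := e ++ d) (t := (e ++ d ++ e) ++ (e ++ d ++ e) ++ p) (r := z) ?_)).2
        conv_lhs => arg 1; rw [h2]
        rw [← hz]
        simp only [List.append_assoc, E]
  · rcases List.append_eq_append_iff.1 h5 with ⟨d, rfl, h6⟩ | ⟨e, rfl, h6⟩
    · have e1 := congrArg List.length h6
      simp only [List.length_append] at e1
      obtain ⟨q, rfl⟩ := List.prefix_of_prefix_length_le (l₁ := p') (l₂ := p) (l₃ := B)
        ⟨A ++ (A ++ p), by rw [h2]; simp⟩ ⟨z, hz⟩ (by omega)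
      simp only [List.length_append] at e1
      have hqz : q ++ z = A ++ (d ++ (A ++ p')) := by
        have := hz.trans h1
        simpa using this
      rcases List.append_eq_append_iff.1 hqz with ⟨r, rfl, h7⟩ | ⟨r, rfl, h7⟩
      · have h8 : q ++ (r ++ (p' ++ q)) = d ++ (q ++ (r ++ p')) := by simpa using h6
        obtain ⟨rfl, h9⟩ := List.append_inj h8 (by omega)
        rcases hB.eq_nil_of_comm (l := p' ++ (q ++ r)) (x := q) (y := r ++ p') (r := [])
          (by rw [h1]; simp [h9]) (by simpa using h9.symm) with rfl | h
        · exact hpAA (by rw [h1]; simp)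
        · exact hp' (List.append_eq_nil_iff.1 h).2
      · refine hp' (List.append_eq_nil_iff.1 (List.append_eq_nil_iff.1
          (hBAAB.eq_nil (l := p' ++ (A ++ d)) (t := A ++ p' ++ A) (r := r) ?_)).1).2
        conv_lhs => arg 1; rw [h1]
        rw [h2]
        simp
    · have h8 : (b ++ e) ++ p' = (e ++ b) ++ (e ++ p) := by simpa using h6
      obtain ⟨h9, rfl⟩ := List.append_inj h8 (by simp [Nat.add_comm])
      rcases hB.eq_nil_of_comm (l := e ++ p) (x := b) (y := e) (r := e ++ p)
        (by rw [h2]; simp) h9 with rfl | rfl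
      · exact hAAp (by rw [h2]; simp)
      · exact hpAA (by rw [h2]; simp)

end Words

section Decidability

variable {α : Type*}

theorem hasCube_iff {w : List α} : HasCube w ↔ ∃ i < w.length, ∃ n < w.length,
    i + 3 * (n + 1) ≤ w.length ∧
    (w.drop i).take (n + 1) = (w.drop (i + (n + 1))).take (n + 1) ∧
    (w.drop i).take (n + 1) = (w.drop (i + 2 * (n + 1))).take (n + 1) := by
  constructor
  · rintro ⟨_, ⟨l, r, rfl⟩, X, hX, rfl⟩
    obtain ⟨n, hn⟩ : ∃ n, X.length = n + 1 :=
      Nat.exists_eq_succ_of_ne_zero (fun h => hX (List.length_eq_zero_iff.1 h))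
    refine ⟨l.length, by simp; omega, n, by simp; omega, by simp; omega, ?_, ?_⟩
    · rw [← hn]; simp
    · have e : (l ++ (X ++ X ++ X) ++ r).drop (l.length + 2 * X.length) = X ++ r := by
        rw [show l ++ (X ++ X ++ X) ++ r = (l ++ (X ++ X)) ++ (X ++ r) by simp]
        exact List.drop_left' (by simp [two_mul])
      rw [← hn, e]
      simp
  · rintro ⟨i, -, n, -, h1, h2, h3⟩
    refine ⟨_, ⟨w.take i, w.drop (i + 3 * (n + 1)), ?_⟩, (w.drop i).take (n + 1), ?_, rfl⟩
    · conv_lhs =>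
        arg 1; arg 2
        rw [h3]; arg 1
        rw [← h3]; arg 2
        rw [h2]
      conv_rhs => rw [← List.take_append_drop i w, ← List.take_append_drop (n + 1) (w.drop i),
        ← List.take_append_drop (n + 1) (List.drop (n + 1) (w.drop i)),
        ← List.take_append_drop (n + 1) (List.drop (n + 1) (List.drop (n + 1) (w.drop i)))]
      simp only [List.drop_drop, List.append_assoc]
      ring_nf
    · intro h
      have := congrArg List.length h
      simp at this
      omega

instance [DecidableEq α] (w : List α) : Decidable (HasCube w) := decidable_of_iff' _ hasCube_iff

instance [DecidableEq α] (w : List α) : Decidable (CubeFree w) :=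
  inferInstanceAs (Decidable (¬ HasCube w))

theorem CubeFree.exists_extend {u : List (Fin 2)} (hu : CubeFree u) (hl : u.length ≤ 6) :
    ∃ c, CubeFree (u ++ [c]) := by
  match u with
  | [] => exact ⟨0, by decide⟩
  | [a] => revert a; decide
  | [a, b] => revert a b; decide
  | [a, b, c] => revert a b c; decide
  | [a, b, c, d] => revert a b c d; decide
  | [a, b, c, d, e] => revert a b c d e; decide
  | [a, b, c, d, e, f] => revert a b c d e f; decide
  | _ :: _ :: _ :: _ :: _ :: _ :: _ :: _ => simp at hl; omega

end Decidability

section Morphisms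

variable {α : Type*}

/-- The morphism with letter images `g` preserves cubefreeness of words of length at most `7`. -/
def PreservesShort (g : Fin 2 → List α) : Prop :=
  ∀ u : List (Fin 2), u.length ≤ 7 → CubeFree u → CubeFree (u.flatMap g)

theorem preservesShort_of_length_eq {g : Fin 2 → List α}
    (h : ∀ u : List (Fin 2), u.length = 7 → CubeFree u → CubeFree (u.flatMap g)) :
    PreservesShort g := by
  have key : ∀ n ≤ 7, ∀ u : List (Fin 2), u.length = 7 - n → CubeFree u →
      CubeFree (u.flatMap g) := by
    intro n
    induction n with
    | zero => exact fun _ => h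
    | succ n ih =>
      intro hn u hu hc
      obtain ⟨c, hc⟩ := hc.exists_extend (by omega)
      exact (ih (by omega) (u ++ [c]) (by simp; omega) hc).mono ⟨[], g c, by simp⟩
  exact fun u hu => key (7 - u.length) (by omega) u (by omega)

theorem reverse_flatMap_eq (g : Fin 2 → List α) (w : List (Fin 2)) :
    (w.flatMap g).reverse = w.reverse.flatMap (fun i => (g i).reverse) := by
  induction w with
  | nil => rfl
  | cons c w ih => simp [ih]

namespace PreservesShort

variable {g : Fin 2 → List α} {a b : Fin 2}

theorem reverse (hg : PreservesShort g) : PreservesShort (fun i => (g i).reverse) := by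
  intro u hu hc
  have := (hg u.reverse (by simpa) hc.reverse).reverse
  rwa [reverse_flatMap_eq, List.reverse_reverse] at this

theorem test (hg : PreservesShort g) (F : Fin 2 → Fin 2 → List (Fin 2))
    (hF : ∀ a b, a ≠ b → (F a b).length ≤ 7 ∧ CubeFree (F a b)) (hab : a ≠ b) :
    CubeFree ((F a b).flatMap g) :=
  hg _ (hF a b hab).1 (hF a b hab).2

end PreservesShort

theorem split_flatMap {g : Fin 2 → List α} {w : List (Fin 2)} {X Y : List α}
    (h : w.flatMap g = X ++ Y) :
    (∃ w₁ w₂, w = w₁ ++ w₂ ∧ w₁.flatMap g = X ∧ w₂.flatMap g = Y) ∨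
    ∃ w₁ c w₂ s p, w = w₁ ++ c :: w₂ ∧ g c = s ++ p ∧ s ≠ [] ∧ p ≠ [] ∧
      X = w₁.flatMap g ++ s ∧ Y = p ++ w₂.flatMap g := by
  induction w generalizing X with
  | nil =>
    have h' : X = [] ∧ Y = [] := by simpa using h.symm
    exact .inl ⟨[], [], rfl, h'.1.symm, h'.2.symm⟩
  | cons c w ih =>
    rw [List.flatMap_cons] at h
    rcases List.append_eq_append_iff.1 h with ⟨Z, rfl, h2⟩ | ⟨Z, h1, rfl⟩
    · rcases ih h2 with ⟨w₁, w₂, rfl, rfl, rfl⟩ | ⟨w₁, d, w₂, s, p, rfl, hd, hs, hp, rfl, rfl⟩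
      · exact .inl ⟨c :: w₁, w₂, rfl, by simp, rfl⟩
      · exact .inr ⟨c :: w₁, d, w₂, s, p, rfl, hd, hs, hp, by simp, rfl⟩
    · rcases eq_or_ne X [] with rfl | hX
      · exact .inl ⟨[], c :: w, rfl, rfl, by rw [List.flatMap_cons, h1]; rfl⟩
      rcases eq_or_ne Z [] with rfl | hZ
      · exact .inl ⟨[c], w, rfl, by simpa using h1, rfl⟩
      · exact .inr ⟨[], c, w, X, Z, rfl, h1, hX, hZ, by simp, rfl⟩

theorem eq_of_ne_two {a b c : Fin 2} (hab : a ≠ b) : c = a ∨ c = b := by omega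

theorem cover_step {g : Fin 2 → List α} {w : List (Fin 2)} {q S : List α} (hq : q ≠ [])
    (h : w.flatMap g = q ++ S) (hcut : ∀ w₁ w₂, w = w₁ ++ w₂ → w₁.flatMap g ≠ q) :
    ∃ c w', w = c :: w' ∧ (q <+: g c ∨ ∃ q', q' ≠ [] ∧ q = g c ++ q' ∧ w'.flatMap g = q' ++ S ∧
      ∀ w₁ w₂, w' = w₁ ++ w₂ → w₁.flatMap g ≠ q') := by
  cases w with
  | nil => simp_all
  | cons c w' =>
    refine ⟨c, w', rfl, ?_⟩
    rw [List.flatMap_cons] at h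
    rcases List.append_eq_append_iff.1 h with ⟨Z, rfl, h2⟩ | ⟨Z, h1, -⟩
    · refine .inr ⟨Z, ?_, rfl, h2, ?_⟩
      · rintro rfl
        exact hcut [c] w' rfl (by simp)
      · rintro w₁ w₂ rfl rfl
        exact hcut (c :: w₁) w₂ rfl (by simp)
    · exact .inl ⟨Z, h1.symm⟩

theorem right_cover {g : Fin 2 → List α} {a b : Fin 2} {w : List (Fin 2)} {q S : List α}
    (hab : a ≠ b) (hw : CubeFree w) (hq : q ≠ []) (hlen : q.length < (g b).length)
    (h : w.flatMap g = q ++ S) (hcut : ∀ w₁ w₂, w = w₁ ++ w₂ → w₁.flatMap g ≠ q) :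
    ([b] <+: w ∧ q <+: g b) ∨ ([a] <+: w ∧ q <+: g a) ∨ ∃ q', q' ≠ [] ∧
      (([a, a] <+: w ∧ q = g a ++ q' ∧ q' <+: g a) ∨ ([a, b] <+: w ∧ q = g a ++ q' ∧ q' <+: g b) ∨
      ([a, a, b] <+: w ∧ q = g a ++ (g a ++ q') ∧ q' <+: g b)) := by
  obtain ⟨c, w, rfl, h1⟩ := cover_step hq h hcut
  rcases eq_of_ne_two (c := c) hab with rfl | rfl
  swap
  · rcases h1 with h1 | ⟨q, -, rfl, -⟩
    · exact .inl ⟨by simp, h1⟩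
    · simp at hlen
  rcases h1 with h1 | ⟨q', hq', rfl, h', hcut'⟩
  · exact .inr (.inl ⟨by simp, h1⟩)
  simp only [List.length_append] at hlen
  obtain ⟨d, w, rfl, h1⟩ := cover_step hq' h' hcut'
  rcases eq_of_ne_two (c := d) hab with rfl | rfl
  swap
  · rcases h1 with h1 | ⟨r, -, rfl, -⟩
    · exact .inr (.inr ⟨q', hq', .inr (.inl ⟨by simp, rfl, h1⟩)⟩)
    · simp at hlen; omega
  rcases h1 with h1 | ⟨q'', hq'', rfl, h'', hcut''⟩
  · exact .inr (.inr ⟨q', hq', .inl ⟨by simp, rfl, h1⟩⟩)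
  simp only [List.length_append] at hlen
  obtain ⟨e, w, rfl, h1⟩ := cover_step hq'' h'' hcut''
  rcases eq_of_ne_two (c := e) hab with rfl | rfl
  · exact absurd (hw.eq_nil (l := []) (t := [e]) (r := w) rfl) (by simp)
  rcases h1 with h1 | ⟨q, -, rfl, -⟩
  · exact .inr (.inr ⟨q'', hq'', .inr (.inr ⟨by simp, rfl, h1⟩)⟩)
  · simp at hlen; omega

theorem prefix_reverse_iff {β : Type*} {u v : List β} : u <+: v.reverse ↔ u.reverse <:+ v := by
  rw [← List.reverse_prefix, List.reverse_reverse]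

theorem left_cover {g : Fin 2 → List α} {a b : Fin 2} {w : List (Fin 2)} {s P : List α}
    (hab : a ≠ b) (hw : CubeFree w) (hs : s ≠ []) (hlen : s.length < (g b).length)
    (h : w.flatMap g = P ++ s) (hcut : ∀ w₁ w₂, w = w₁ ++ w₂ → w₂.flatMap g ≠ s) :
    ([b] <:+ w ∧ s <:+ g b) ∨ ([a] <:+ w ∧ s <:+ g a) ∨ ∃ s', s' ≠ [] ∧
      (([a, a] <:+ w ∧ s = s' ++ g a ∧ s' <:+ g a) ∨ ([b, a] <:+ w ∧ s = s' ++ g a ∧ s' <:+ g b) ∨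
      ([b, a, a] <:+ w ∧ s = s' ++ (g a ++ g a) ∧ s' <:+ g b)) := by
  have key := right_cover (g := fun i => (g i).reverse) (w := w.reverse) (q := s.reverse)
    (S := P.reverse) hab hw.reverse (by simpa) (by simpa)
    (by rw [← reverse_flatMap_eq, h]; simp) (by
      intro w₁ w₂ h1 h2
      refine hcut w₂.reverse w₁.reverse (by simpa using congrArg List.reverse h1) ?_
      have := congrArg List.reverse h2
      rw [reverse_flatMap_eq] at this
      simpa using this)
  have e' : ∀ {u v : List α}, u.reverse = v ↔ u = v.reverse := by
    intro u v
    constructor <;> rintro rfl <;> simp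
  simp only [prefix_reverse_iff, List.reverse_reverse, e'] at key
  rcases key with h | h | ⟨q, hq, h⟩
  · exact .inl h
  · exact .inr (.inl h)
  · exact .inr (.inr ⟨q.reverse, by simpa, by simpa using h⟩)

/-- No cut of `w` is sent by `g` to one of the three cuts of the factor `X ++ Y` after `P`. -/
def NoCut (g : Fin 2 → List α) (w : List (Fin 2)) (P X Y : List α) : Prop :=
  ∀ w₁ w₂, w = w₁ ++ w₂ → w₁.flatMap g ≠ P ∧ w₁.flatMap g ≠ P ++ X ∧ w₁.flatMap g ≠ P ++ (X ++ Y)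

theorem NoCut.exists_straddle {g : Fin 2 → List α} {w : List (Fin 2)} {P X Y S : List α}
    (hcut : NoCut g w P X Y) (h : w.flatMap g = P ++ (X ++ Y) ++ S) :
    ∃ w₁ c w₂ s p, w = w₁ ++ c :: w₂ ∧ g c = s ++ p ∧ s ≠ [] ∧ p ≠ [] ∧
      P ++ X = w₁.flatMap g ++ s ∧ Y ++ S = p ++ w₂.flatMap g := by
  rcases split_flatMap (X := P ++ X) (Y := Y ++ S) (by rw [h]; simp) with ⟨w₁, w₂, h1, h2, -⟩ | h
  · exact absurd h2 (hcut _ _ h1).2.1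
  · exact h

theorem NoCut.left {g : Fin 2 → List α} {w₁ w₂ : List (Fin 2)} {P X Y s : List α}
    (hcut : NoCut g (w₁ ++ w₂) P X Y) (h : P ++ X = w₁.flatMap g ++ s) (hs : s.length ≤ X.length) :
    ∃ z, X = z ++ s ∧ z ≠ [] ∧ w₁.flatMap g = P ++ z ∧
      ∀ t₁ t₂, w₁ = t₁ ++ t₂ → t₂.flatMap g ≠ z := by
  obtain ⟨z, h1, h2⟩ : ∃ z, w₁.flatMap g = P ++ z ∧ X = z ++ s := by
    rcases List.append_eq_append_iff.1 h with h | ⟨z, h1, rfl⟩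
    · exact h
    · have hz : z = [] := by simpa using hs
      exact ⟨[], by simp [h1, hz], by simp [hz]⟩
  refine ⟨z, h2, ?_, h1, ?_⟩
  · rintro rfl
    exact (hcut _ _ rfl).1 (by simpa using h1)
  · rintro t₁ t₂ rfl rfl
    exact (hcut t₁ (t₂ ++ w₂) (by simp)).1 (by simpa using h1)

theorem NoCut.right {g : Fin 2 → List α} {w₁ w₂ : List (Fin 2)} {c : Fin 2} {P X Y S s p : List α}
    (hcut : NoCut g (w₁ ++ c :: w₂) P X Y) (hX : P ++ X = w₁.flatMap g ++ s) (hc : g c = s ++ p)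
    (h : Y ++ S = p ++ w₂.flatMap g) (hp : p.length ≤ Y.length) :
    ∃ q, Y = p ++ q ∧ q ≠ [] ∧ w₂.flatMap g = q ++ S ∧
      ∀ t₁ t₂, w₂ = t₁ ++ t₂ → t₁.flatMap g ≠ q := by
  obtain ⟨q, h1, h2⟩ : ∃ q, Y = p ++ q ∧ w₂.flatMap g = q ++ S := by
    rcases List.append_eq_append_iff.1 h with ⟨z, rfl, h1⟩ | h
    · have hz : z = [] := by simpa using hp
      exact ⟨[], by simp [hz], by simp [h1, hz]⟩
    · exact h
  refine ⟨q, h1, ?_, h2, ?_⟩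
  · rintro rfl
    refine (hcut (w₁ ++ [c]) w₂ (by simp)).2.2 ?_
    rw [← List.append_assoc, hX]
    simp [hc, h1]
  · rintro t₁ t₂ rfl rfl
    refine (hcut (w₁ ++ c :: t₁) t₂ (by simp)).2.2 ?_
    rw [← List.append_assoc, hX]
    simp [hc, h1]

/-- A word with cubefree square has no factorisation into two commuting nonempty words. -/
theorem CubeFree.false_of_swap {B s p : List α} (h : CubeFree (B ++ B)) (hs : s ≠ []) (hp : p ≠ [])
    (h1 : B = s ++ p) (h2 : B = p ++ s) : False := by
  rcases h.eq_nil_of_sq (l := s) (r := p) (by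
    conv_lhs => rw [h1]
    rw [h2]; simp) with h | h
  exacts [hs h, hp h]

theorem noCut_bb {g : Fin 2 → List α} {a b : Fin 2} (hg : PreservesShort g) (hab : a ≠ b)
    (hle : (g a).length ≤ (g b).length) {w : List (Fin 2)} {P S : List α} (hw : CubeFree w)
    (h : w.flatMap g = P ++ (g b ++ g b) ++ S) (hcut : NoCut g w P (g b) (g b)) : False := by
  have hBB : CubeFree (g b ++ g b) := by
    simpa using hg.test (fun _ b => [b, b]) (by decide) hab
  have hAB : CubeFree (g a ++ g b) := by
    simpa using hg.test (fun a b => [a, b]) (by decide) hab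
  have hBA : CubeFree (g b ++ g a) := by
    simpa using hg.test (fun a b => [b, a]) (by decide) hab
  obtain ⟨w₁, c, w₂, s', p', rfl, hc, hs', hp', hX, hY⟩ := hcut.exists_straddle h
  have hcl := congrArg List.length hc
  have hs'l := List.length_pos_iff.2 hs'
  have hp'l := List.length_pos_iff.2 hp'
  rw [List.length_append] at hcl
  have hcb : (g c).length ≤ (g b).length := by
    rcases eq_of_ne_two (c := c) hab with rfl | rfl
    exacts [hle, le_rfl]
  obtain ⟨s, hBs, hs, hw₁, hcutL⟩ := hcut.left hX (by omega)
  obtain ⟨p, hBp, hp, hw₂, hcutR⟩ := hcut.right hX hc hY (by omega)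
  have hBsl := congrArg List.length hBs
  have hBpl := congrArg List.length hBp
  rw [List.length_append] at hBsl hBpl
  rcases eq_of_ne_two (c := c) hab with rfl | rfl
  swap
  · have : s.length = p'.length := by omega
    refine hBB.false_of_swap hs' hp' hc ?_
    rcases hBB.eq_nil_of_sq (l := s) (r := p) (by
      conv_lhs => lhs; rw [hBs]
      conv_lhs => rhs; rw [hBp]
      rw [hc]; simp) with h | h
    exacts [absurd h hs, absurd h hp]
  have naaa : ∀ l r : List (Fin 2), l ++ [c, c, c] ++ r = w₁ ++ c :: w₂ → False := fun l r h =>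
    absurd (hw.eq_nil (l := l) (t := [c]) (r := r) (by simp [← h])) (by simp)
  rcases left_cover hab (hw.mono ⟨[], c :: w₂, by simp⟩) hs (by omega) hw₁ hcutL with
    ⟨-, L⟩ | ⟨⟨l, rfl⟩, L⟩ | ⟨t, -, ⟨⟨l, rfl⟩, -⟩ | ⟨⟨l, rfl⟩, rfl, L⟩ | ⟨⟨l, rfl⟩, -⟩⟩
  · rcases right_cover hab (hw.mono ⟨w₁ ++ [c], [], by simp⟩) hp (by omega) hw₂ hcutR with
      ⟨-, R⟩ | ⟨-, R⟩ | ⟨q, -, ⟨⟨r, rfl⟩, -⟩ | ⟨-, rfl, R⟩ | ⟨⟨r, rfl⟩, -⟩⟩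
    · exact cover_bab_bb hle hs' hp' hAB hBA hc hBp R hBs L
    · exact cover_baa_bb hle hs' hp' hAB hBA hc hBp R hBs L
    · exact naaa w₁ r (by simp)
    · exact cover_baab_bb hp' hAB hc hBs L hBp
    · exact naaa w₁ (b :: r) (by simp)
  · rcases right_cover hab (hw.mono ⟨l ++ [c] ++ [c], [], by simp⟩) hp (by omega) hw₂ hcutR with
      ⟨-, R⟩ | ⟨⟨r, rfl⟩, -⟩ | ⟨q, -, ⟨⟨r, rfl⟩, -⟩ | ⟨⟨r, rfl⟩, -⟩ | ⟨⟨r, rfl⟩, -⟩⟩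
    · exact cover_aab_bb hle hs' hp' hAB hBA hc hBs L hBp R
    · exact naaa l r (by simp)
    · exact naaa l (c :: r) (by simp)
    · exact naaa l (b :: r) (by simp)
    · exact naaa l (c :: b :: r) (by simp)
  · exact naaa l w₂ (by simp)
  · rcases right_cover hab (hw.mono ⟨l ++ [b, c] ++ [c], [], by simp⟩) hp (by omega) hw₂ hcutR with
      ⟨-, R⟩ | ⟨⟨r, rfl⟩, -⟩ | ⟨q, -, ⟨⟨r, rfl⟩, -⟩ | ⟨⟨r, rfl⟩, -⟩ | ⟨⟨r, rfl⟩, -⟩⟩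
    · exact cover_baab_bb' hs' hBA hc hBp R (by simpa using hBs)
    · exact naaa (l ++ [b]) r (by simp)
    · exact naaa (l ++ [b]) (c :: r) (by simp)
    · exact naaa (l ++ [b]) (b :: r) (by simp)
    · exact naaa (l ++ [b]) (c :: b :: r) (by simp)
  · exact naaa (l ++ [b]) w₂ (by simp)

theorem noCut_ab {g : Fin 2 → List α} {a b : Fin 2} (hg : PreservesShort g) (hab : a ≠ b)
    (hle : (g a).length ≤ (g b).length) {w : List (Fin 2)} {P S : List α} (hw : CubeFree w)
    (h : w.flatMap g = P ++ (g a ++ g b) ++ S) (hcut : NoCut g w P (g a) (g b)) : False := by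
  have hAA : CubeFree (g a ++ g a) := by
    simpa using hg.test (fun a _ => [a, a]) (by decide) hab
  have hBB : CubeFree (g b ++ g b) := by
    simpa using hg.test (fun _ b => [b, b]) (by decide) hab
  have hABA : CubeFree (g a ++ g b ++ g a) := by
    simpa using hg.test (fun a b => [a, b, a]) (by decide) hab
  have hBAB : CubeFree (g b ++ g a ++ g b) := by
    simpa using hg.test (fun a b => [b, a, b]) (by decide) hab
  have hBAA : CubeFree (g b ++ g a ++ g a) := by
    simpa using hg.test (fun a b => [b, a, a]) (by decide) hab
  have hABAA : CubeFree (g a ++ g b ++ g a ++ g a) := by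
    simpa using hg.test (fun a b => [a, b, a, a]) (by decide) hab
  have hBAAB : CubeFree (g b ++ g a ++ g a ++ g b) := by
    simpa using hg.test (fun a b => [b, a, a, b]) (by decide) hab
  have hABAAB : CubeFree (g a ++ g b ++ g a ++ g a ++ g b) := by
    simpa using hg.test (fun a b => [a, b, a, a, b]) (by decide) hab
  obtain ⟨w₁, c, w₂, s', p', rfl, hc, hs', hp', hX, hY⟩ := hcut.exists_straddle h
  have hcl := congrArg List.length hc
  have hs'l := List.length_pos_iff.2 hs'
  have hp'l := List.length_pos_iff.2 hp'
  rw [List.length_append] at hcl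
  have hcb : (g c).length ≤ (g b).length := by
    rcases eq_of_ne_two (c := c) hab with rfl | rfl
    exacts [hle, le_rfl]
  obtain ⟨p, hBp, hp, hw₂, hcutR⟩ := hcut.right hX hc hY (by omega)
  have hBpl := congrArg List.length hBp
  rw [List.length_append] at hBpl
  rcases eq_of_ne_two (c := c) hab with rfl | rfl
  · obtain ⟨s, hAs, hs, hw₁, hcutL⟩ := hcut.left hX (by omega)
    have hAsl := congrArg List.length hAs
    rw [List.length_append] at hAsl
    rcases left_cover hab (hw.mono ⟨[], c :: w₂, by simp⟩) hs (by omega) hw₁ hcutL with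
      ⟨-, z, L⟩ | ⟨-, z, L⟩ | ⟨t, -, ⟨-, rfl, -⟩ | ⟨-, rfl, -⟩ | ⟨-, rfl, -⟩⟩
    · exact hs (hBAB.eq_nil_of_conj hAs hc hBp L.symm)
    · obtain rfl : s = p' := (List.append_inj' (L.trans hc) (by omega)).2
      exact hAA.false_of_swap hs' hp' hc hAs
    all_goals simp at hAsl; omega
  have hR := right_cover hab (hw.mono ⟨w₁ ++ [c], [], by simp⟩) hp (by omega) hw₂ hcutR
  have hne : ¬ p <+: g c := by
    rintro ⟨z, R⟩
    obtain rfl : p = s' := (List.append_inj (R.trans hc) (by omega)).1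
    exact hBB.false_of_swap hs' hp' hc hBp
  rcases le_or_gt s'.length (g a).length with hl | hl
  · obtain ⟨s, hAs, hs, -⟩ := hcut.left hX hl
    rcases hR with ⟨-, R⟩ | ⟨-, z, R⟩ | ⟨t, ht, ⟨-, rfl, -⟩ | ⟨-, rfl, -⟩ | ⟨-, rfl, -⟩⟩
    · exact hne R
    · exact hs' (hABA.eq_nil_of_conj hc hBp R.symm hAs)
    all_goals
      have := List.length_pos_iff.2 ht
      simp at hBpl; omega
  · obtain ⟨c', rfl⟩ : ∃ c', s' = c' ++ g a := by
      obtain ⟨c', h⟩ := List.suffix_of_suffix_length_le (l₁ := g a) (l₂ := s') (l₃ := P ++ g a)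
        ⟨P, rfl⟩ ⟨_, hX.symm⟩ hl.le
      exact ⟨c', h.symm⟩
    have hc' : c' ≠ [] := by
      rintro rfl
      simp at hl
    simp only [List.length_append] at hcl hl
    rcases hR with ⟨-, R⟩ | ⟨-, R⟩ | ⟨t, ht, ⟨-, rfl, R⟩ | ⟨-, rfl, R⟩ | ⟨-, rfl, R⟩⟩
    · exact hne R
    · have := R.length_le
      omega
    · exact cover_baa_ab hp' ht hBAB hBAA hABAA hc (by simpa using hBp) R
    · exact cover_bab_ab hc' hp' hBAB hc (by simpa using hBp) R
    · exact cover_baab_ab hp' ht hBAAB hABAAB hc (by simpa using hBp) R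

theorem NoCut.reverse {g : Fin 2 → List α} {w : List (Fin 2)} {P X Y S : List α}
    (hcut : NoCut g w P X Y) (h : w.flatMap g = P ++ (X ++ Y) ++ S) :
    NoCut (fun i => (g i).reverse) w.reverse S.reverse Y.reverse X.reverse := by
  intro w₁ w₂ hw
  obtain rfl : w = w₂.reverse ++ w₁.reverse := by simpa using congrArg List.reverse hw
  have key : ∀ Z T : List α, P ++ (X ++ Y) ++ S = Z ++ T →
      w₁.flatMap (fun i => (g i).reverse) = T.reverse → w₂.reverse.flatMap g = Z := by
    intro Z T h1 h2
    have h3 : w₁.reverse.flatMap g = T := by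
      have := congrArg List.reverse h2
      rw [reverse_flatMap_eq] at this
      simpa using this
    rw [h1, List.flatMap_append, h3] at h
    exact List.append_cancel_right h
  obtain ⟨c1, c2, c3⟩ := hcut _ _ rfl
  exact ⟨fun e => c3 (key _ S rfl e), fun e => c2 (key _ (Y ++ S) (by simp) (by simpa using e)),
    fun e => c1 (key _ (X ++ (Y ++ S)) (by simp) (by simpa using e))⟩

/-- An occurrence, in the image of a cubefree word, of the image of a two-letter word other than
`aa` (with `a` the letter with the shorter image) shares a cut with the ambient parsing. -/
theorem exists_common_cut {g : Fin 2 → List α} {a b : Fin 2} (hg : PreservesShort g) (hab : a ≠ b)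
    (hle : (g a).length ≤ (g b).length) {w : List (Fin 2)} {P S : List α} {x y : Fin 2}
    (hxy : ¬ (x = a ∧ y = a)) (hw : CubeFree w) (h : w.flatMap g = P ++ [x, y].flatMap g ++ S) :
    ∃ w₁ w₂ u₁ u₂, w = w₁ ++ w₂ ∧ [x, y] = u₁ ++ u₂ ∧ w₁.flatMap g = P ++ u₁.flatMap g := by
  by_contra! hno
  have h' : w.flatMap g = P ++ (g x ++ g y) ++ S := by simpa using h
  have hcut : NoCut g w P (g x) (g y) := fun w₁ w₂ hw' =>
    ⟨by simpa using hno w₁ w₂ [] [x, y] hw' rfl, by simpa using hno w₁ w₂ [x] [y] hw' rfl,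
      by simpa using hno w₁ w₂ [x, y] [] hw' rfl⟩
  rcases eq_of_ne_two (c := x) hab with rfl | rfl <;>
    rcases eq_of_ne_two (c := y) hab with rfl | rfl
  · exact hxy ⟨rfl, rfl⟩
  · exact noCut_ab hg hab hle hw h' hcut
  · refine noCut_ab (S := P.reverse) hg.reverse hab (by simpa) hw.reverse ?_ (hcut.reverse h')
    rw [← reverse_flatMap_eq, h']
    simp
  · exact noCut_bb hg hab hle hw h' hcut

theorem PreservesShort.eq_of_prefix {g : Fin 2 → List α} (hg : PreservesShort g) {x y : Fin 2}
    (hx : g x ≠ []) (h : g x <+: g y) : x = y := by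
  by_contra hxy
  obtain ⟨z, hz⟩ := h
  have := hg.test (fun x y => [x, x, y]) (by decide) hxy
  exact hx (this.eq_nil (l := []) (r := z) (by simp [← hz]))

theorem PreservesShort.eq_of_suffix {g : Fin 2 → List α} (hg : PreservesShort g) {x y : Fin 2}
    (hx : g x ≠ []) (h : g x <:+ g y) : x = y :=
  hg.reverse.eq_of_prefix (by simpa) (List.reverse_prefix.2 h)

theorem PreservesShort.eq_of_append_eq {g : Fin 2 → List α} (hg : PreservesShort g)
    (hne : ∀ i, g i ≠ []) {x y : Fin 2} {R R' : List α} (h : g x ++ R = g y ++ R') : x = y := by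
  rcases List.prefix_or_prefix_of_prefix (l₁ := g x) (l₂ := g y) ⟨R, rfl⟩ ⟨R', h.symm⟩ with h | h
  exacts [hg.eq_of_prefix (hne x) h, (hg.eq_of_prefix (hne y) h).symm]

theorem PreservesShort.prefix_of_flatMap {g : Fin 2 → List α} (hg : PreservesShort g)
    (hne : ∀ i, g i ≠ []) {v r : List (Fin 2)} {R : List α}
    (h : r.flatMap g = v.flatMap g ++ R) : ∃ r', r = v ++ r' ∧ r'.flatMap g = R := by
  induction v generalizing r with
  | nil => exact ⟨r, rfl, by simpa using h⟩
  | cons c v ih =>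
    cases r with
    | nil => simp [hne] at h
    | cons d r =>
      simp only [List.flatMap_cons, List.append_assoc] at h
      obtain rfl := hg.eq_of_append_eq hne h
      obtain ⟨r', rfl, h'⟩ := ih (List.append_cancel_left h)
      exact ⟨r', rfl, h'⟩

theorem false_of_synchronized_short {g : Fin 2 → List α} (hg : PreservesShort g)
    (hne : ∀ i, g i ≠ []) {w₁ v' r : List (Fin 2)} {y : Fin 2} {A G P S : List α}
    (hw : CubeFree (w₁ ++ (v' ++ [y]) ++ r)) (h1 : w₁.flatMap g = P ++ A)
    (hr : r.flatMap g = G ++ S) (hA : A <:+ A ++ (v' ++ [y]).flatMap g)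
    (hG : G <+: (v' ++ [y]).flatMap g ++ G)
    (hl : 2 * ((v' ++ [y]).flatMap g).length ≤ A.length + G.length)
    (hAy : A.length < (g y).length) : False := by
  obtain ⟨p, hp⟩ : A <:+ g y := by
    refine List.suffix_of_suffix_length_le hA ⟨A ++ v'.flatMap g, ?_⟩ hAy.le
    simp
  have hpl : p.length + A.length = (g y).length := by simpa using congrArg List.length hp
  have hp0 : p ≠ [] := by
    rintro rfl
    simp at hpl; omega
  simp only [List.flatMap_append, List.flatMap_cons, List.flatMap_nil, List.append_nil,
    List.length_append] at hl hG
  obtain ⟨G₁, rfl⟩ : v'.flatMap g ++ g y <+: G :=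
    List.prefix_of_prefix_length_le (l₃ := v'.flatMap g ++ g y ++ G) ⟨_, rfl⟩ hG
      (by simp only [List.length_append]; omega)
  simp only [List.length_append] at hl
  rw [List.prefix_append_right_inj] at hG
  obtain ⟨G₂, rfl⟩ : v'.flatMap g <+: G₁ :=
    List.prefix_of_prefix_length_le (l₃ := v'.flatMap g ++ g y ++ G₁) ⟨g y ++ G₁, by simp⟩ hG
      (by omega)
  simp only [List.length_append] at hl
  rw [List.append_assoc, List.prefix_append_right_inj] at hG
  obtain ⟨G₃, rfl⟩ : p <+: G₂ :=
    List.prefix_of_prefix_length_le (l₃ := g y ++ (v'.flatMap g ++ G₂))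
      ⟨A ++ (v'.flatMap g ++ G₂), by rw [← hp]; simp⟩ hG (by omega)
  obtain ⟨r', rfl, hr'⟩ := hg.prefix_of_flatMap hne (v := v' ++ [y] ++ v') (r := r)
    (R := p ++ G₃ ++ S) (by simpa using hr)
  obtain ⟨z, r', rfl⟩ : ∃ z r'', r' = z :: r'' := by
    cases r' with
    | nil => simp [hp0] at hr'
    | cons z r'' => exact ⟨z, r'', rfl⟩
  simp only [List.flatMap_cons, List.append_assoc] at hr'
  have hzy : z ≠ y := by
    rintro rfl
    exact absurd (hw.eq_nil (l := w₁) (t := v' ++ [z]) (r := r') (by simp)) (by simp)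
  have hA0 : A ≠ [] := by
    rintro rfl
    rw [List.append_nil] at hp
    subst hp
    exact hzy (hg.eq_of_append_eq hne hr')
  obtain ⟨w₀, x, rfl⟩ : ∃ w₀ x, w₁ = w₀ ++ [x] := by
    rcases List.eq_nil_or_concat w₁ with rfl | ⟨w₀, x, rfl⟩
    · simp [hA0] at h1
    · exact ⟨w₀, x, by simp⟩
  have hxy : x ≠ y := by
    rintro rfl
    exact absurd (hw.eq_nil (l := w₀) (t := x :: v') (r := z :: r') (by simp)) (by simp)
  obtain rfl : x = z := by omega
  obtain ⟨s, hs⟩ : p <+: g x := by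
    rcases List.prefix_or_prefix_of_prefix (l₁ := p) (l₂ := g x) ⟨_, rfl⟩ ⟨_, hr'⟩ with h | h
    · exact h
    · exact absurd (hg.eq_of_prefix (hne x) (h.trans ⟨A, hp⟩)) hxy
  obtain ⟨t, ht⟩ : A <:+ g x := by
    rcases List.suffix_or_suffix_of_suffix (l₁ := A) (l₂ := g x) ⟨P, rfl⟩
      ⟨w₀.flatMap g, by simpa using h1⟩ with h | h
    · exact h
    · exact absurd (hg.eq_of_suffix (hne x) (h.trans ⟨p, hp⟩)) hxy
  have h4 := hg.test (fun x y => [x, y, y, x]) (by decide) hxy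
  refine hp0 (List.append_eq_nil_iff.1 (h4.eq_nil (l := t) (t := A ++ p) (r := s) ?_)).2
  simp only [List.flatMap_cons, List.flatMap_nil, ← hp]
  conv_lhs => lhs; rw [← ht]
  rw [← hs]
  simp

/-- If a factor of the image of a cubefree word has length at least three times its period, then
no two of its cuts lie exactly one period apart. -/
theorem false_of_synchronized {g : Fin 2 → List α} (hg : PreservesShort g)
    (hne : ∀ i, g i ≠ []) {w₁ v r : List (Fin 2)} {A G P S : List α}
    (hw : CubeFree (w₁ ++ v ++ r)) (hv : v ≠ []) (h1 : w₁.flatMap g = P ++ A)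
    (hr : r.flatMap g = G ++ S) (hA : A <:+ A ++ v.flatMap g)
    (hG : G <+: v.flatMap g ++ G) (hl : 2 * (v.flatMap g).length ≤ A.length + G.length) :
    False := by
  induction w₁ using List.reverseRecOn generalizing v r A G with
  | nil =>
    obtain ⟨v', y, rfl⟩ : ∃ v' y, v = v' ++ [y] := by
      rcases List.eq_nil_or_concat v with rfl | ⟨v', y, rfl⟩
      · exact absurd rfl hv
      · exact ⟨v', y, by simp⟩
    obtain ⟨rfl, rfl⟩ : P = [] ∧ A = [] := by simpa using h1
    exact false_of_synchronized_short hg hne hw h1 hr hA hG hl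
      (List.length_pos_iff.2 (hne y))
  | append_singleton w₀ x ih =>
    obtain ⟨v', y, rfl⟩ : ∃ v' y, v = v' ++ [y] := by
      rcases List.eq_nil_or_concat v with rfl | ⟨v', y, rfl⟩
      · exact absurd rfl hv
      · exact ⟨v', y, by simp⟩
    rcases lt_or_ge A.length (g y).length with h | h
    · exact false_of_synchronized_short hg hne hw h1 hr hA hG hl h
    obtain ⟨A, rfl⟩ : g y <:+ A :=
      List.suffix_of_suffix_length_le (l₃ := A ++ (v' ++ [y]).flatMap g)
        ⟨A ++ v'.flatMap g, by simp⟩ hA h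
    obtain rfl : x = y := by
      rcases List.suffix_or_suffix_of_suffix (l₁ := g x) (l₂ := g y)
        ⟨w₀.flatMap g, by simpa using h1⟩ ⟨P ++ A, by simp⟩ with h | h
      exacts [hg.eq_of_suffix (hne x) h, (hg.eq_of_suffix (hne y) h).symm]
    refine ih (v := x :: v') (r := x :: r) (A := A) (G := g x ++ G) (by simpa using hw) (by simp)
      ?_ ?_ ?_ ?_ ?_
    · simpa [← List.append_assoc] using h1
    · simp [hr]
    · obtain ⟨t, ht⟩ := hA
      exact ⟨t, List.append_cancel_right (bs := g x) (by simpa using ht)⟩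
    · simpa [List.prefix_append_right_inj] using hG
    · simp at hl ⊢
      omega

theorem false_of_shifted_cut {g : Fin 2 → List α} (hg : PreservesShort g)
    (hne : ∀ i, g i ≠ []) {w c₁ c₂ r₁ r₂ : List (Fin 2)} {A G P S U : List α} (hw : CubeFree w)
    (hU : U ≠ []) (h : w.flatMap g = P ++ (U ++ U ++ U) ++ S) (h1 : w = c₁ ++ r₁)
    (h2 : w = c₂ ++ r₂) (hAG : U ++ U = A ++ G) (hc₁ : c₁.flatMap g = P ++ A)
    (hc₂ : c₂.flatMap g = P ++ U ++ A) : False := by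
  have hUl := List.length_pos_iff.2 hU
  obtain ⟨v, rfl⟩ : c₁ <+: c₂ := by
    rcases List.prefix_or_prefix_of_prefix (l₁ := c₁) (l₂ := c₂) ⟨_, h1.symm⟩ ⟨_, h2.symm⟩ with
      h | ⟨t, rfl⟩
    · exact h
    · have := congrArg List.length hc₁
      rw [List.flatMap_append, hc₂] at this
      simp at this; omega
  have hAv : A ++ v.flatMap g = U ++ A := by simpa [hc₁] using hc₂
  have hvl : (v.flatMap g).length = U.length := by
    have := congrArg List.length hAv
    simp only [List.length_append] at this
    omega
  have hGU : v.flatMap g ++ G = G ++ U := by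
    have : A ++ (v.flatMap g ++ G) = A ++ (G ++ U) := by
      rw [← List.append_assoc, hAv, List.append_assoc, ← hAG, ← List.append_assoc,
        ← List.append_assoc, hAG]
    exact List.append_cancel_left this
  subst h2
  refine false_of_synchronized hg hne (A := A) (G := G) (S := S) hw ?_ hc₁ ?_ ⟨U, hAv.symm⟩
    ⟨U, hGU.symm⟩ ?_
  · rintro rfl
    simp at hvl; omega
  · rw [List.flatMap_append, hc₂] at h
    have : P ++ U ++ A ++ r₂.flatMap g = P ++ U ++ A ++ (G ++ S) := by
      rw [h]
      simp only [List.append_assoc]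
      rw [← List.append_assoc A G S, ← hAG]
      simp
    exact List.append_cancel_left this
  · have := congrArg List.length hAG
    simp only [List.length_append] at this
    omega

theorem CubeFree.exists_pair {a x y z : Fin 2} (h : CubeFree [x, y, z]) :
    ∃ m s t m', [x, y, z] = m ++ [s, t] ++ m' ∧ ¬ (s = a ∧ t = a) := by
  by_cases hxy : x = a ∧ y = a
  · refine ⟨[x], y, z, [], rfl, ?_⟩
    rintro ⟨rfl, rfl⟩
    obtain ⟨rfl, -⟩ := hxy
    exact absurd (h.eq_nil (l := []) (t := [x]) (r := []) rfl) (by simp)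
  · exact ⟨[], x, y, [z], rfl, hxy⟩

theorem CubeFree.exists_inner_pairs {w : List (Fin 2)} (a : Fin 2) (hw : CubeFree w)
    (hl : 7 < w.length) : ∃ x w' y m s₁ t₁ m' s₂ t₂ m'', w = x :: w' ++ [y] ∧
      w' = m ++ [s₁, t₁] ++ m' ++ [s₂, t₂] ++ m'' ∧ ¬ (s₁ = a ∧ t₁ = a) ∧ ¬ (s₂ = a ∧ t₂ = a) := by
  obtain ⟨x, d₁, d₂, d₃, d₄, d₅, d₆, e, y, rfl⟩ : ∃ x d₁ d₂ d₃ d₄ d₅ d₆ e y,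
      w = x :: (d₁ :: d₂ :: d₃ :: d₄ :: d₅ :: d₆ :: e) ++ [y] := by
    match w with
    | x :: d₁ :: d₂ :: d₃ :: d₄ :: d₅ :: d₆ :: y :: t =>
      rcases List.eq_nil_or_concat (y :: t) with h | ⟨e, z, h⟩
      · simp at h
      · exact ⟨x, d₁, d₂, d₃, d₄, d₅, d₆, e, z, by simp [h]⟩
    | [] | [_] | [_, _] | [_, _, _] | [_, _, _, _] | [_, _, _, _, _] | [_, _, _, _, _, _]
    | [_, _, _, _, _, _, _] => simp at hl
  obtain ⟨m₁, s₁, t₁, m₁', e₁, hst₁⟩ := CubeFree.exists_pair (a := a) (x := d₁) (y := d₂) (z := d₃)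
    (hw.mono ⟨[x], d₄ :: d₅ :: d₆ :: e ++ [y], by simp⟩)
  obtain ⟨m₂, s₂, t₂, m₂', e₂, hst₂⟩ := CubeFree.exists_pair (a := a) (x := d₄) (y := d₅) (z := d₆)
    (hw.mono ⟨[x, d₁, d₂, d₃], e ++ [y], by simp⟩)
  refine ⟨x, _, y, m₁, s₁, t₁, m₁' ++ m₂, s₂, t₂, m₂' ++ e, rfl, ?_, hst₁, hst₂⟩
  calc
    _ = [d₁, d₂, d₃] ++ ([d₄, d₅, d₆] ++ e) := rfl
    _ = _ := by rw [e₁, e₂]; simp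

theorem PreservesShort.cubeFree_flatMap {g : Fin 2 → List α} {a b : Fin 2} (hg : PreservesShort g)
    (hne : ∀ i, g i ≠ []) (hab : a ≠ b) (hle : (g a).length ≤ (g b).length) (w : List (Fin 2))
    (hw : CubeFree w) : CubeFree (w.flatMap g) := by
  induction hn : w.length using Nat.strong_induction_on generalizing w with
  | _ n ih =>
  subst hn
  rcases le_or_gt w.length 7 with hl | hl
  · exact hg w hl hw
  rintro ⟨_, ⟨P, S, h⟩, U, hU, rfl⟩
  replace h := h.symm
  obtain ⟨x, w', y, m₁, s₁, t₁, n₂, s₂, t₂, n₃, rfl, hw', hst₁, hst₂⟩ := hw.exists_inner_pairs a hl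
  obtain ⟨p, hp⟩ : P <+: g x := by
    rcases List.prefix_or_prefix_of_prefix (l₁ := P) (l₂ := g x) ⟨_, rfl⟩
      ⟨(w' ++ [y]).flatMap g, by rw [← List.append_assoc, ← h]; simp⟩ with h' | ⟨P', rfl⟩
    · exact h'
    · refine absurd ⟨_, ⟨P', S, ?_⟩, U, hU, rfl⟩ (ih _ (by simp) (w' ++ [y])
        (hw.mono ⟨[x], [], by simp⟩) rfl)
      simpa using h.symm
  obtain ⟨s, hs⟩ : S <:+ g y := by
    rcases List.suffix_or_suffix_of_suffix (l₁ := S) (l₂ := g y) ⟨_, rfl⟩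
      ⟨(x :: w').flatMap g, by rw [← h]; simp⟩ with h' | ⟨S', rfl⟩
    · exact h'
    · refine absurd ⟨_, ⟨P, S', ?_⟩, U, hU, rfl⟩ (ih _ (by simp) (x :: w')
        (hw.mono ⟨[], [y], by simp⟩) rfl)
      simpa [← List.append_assoc] using h.symm
  have hU3 : U ++ U ++ U = p ++ w'.flatMap g ++ s := by
    simp only [List.cons_append, List.flatMap_cons, List.flatMap_append, ← hp, ← hs,
      List.flatMap_nil] at h
    have : P ++ (p ++ w'.flatMap g ++ s) ++ S = P ++ (U ++ U ++ U) ++ S := by simpa using h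
    exact (List.append_cancel_left (List.append_cancel_right this)).symm
  have hUl := congrArg List.length hU3
  simp only [hw', List.flatMap_append, List.length_append] at hUl
  rcases le_or_gt (p ++ m₁.flatMap g ++ [s₁, t₁].flatMap g).length (U ++ U).length with hc | hc
  · obtain ⟨L, hL⟩ : p ++ m₁.flatMap g ++ [s₁, t₁].flatMap g <+: U ++ U := by
      refine List.prefix_of_prefix_length_le (l₃ := U ++ U ++ U) ?_ ⟨U, rfl⟩ hc
      rw [hU3, hw']
      exact ⟨(n₂ ++ [s₂, t₂] ++ n₃).flatMap g ++ s, by simp⟩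
    obtain ⟨w₁, w₂, u₁, u₂, h1, h2, h3⟩ := exists_common_cut hg hab hle hst₁ hw
      (P := P ++ U ++ p ++ m₁.flatMap g) (S := L ++ S) (by
        rw [h, List.append_assoc U, ← hL]; simp)
    refine false_of_shifted_cut hg hne hw hU h (c₁ := x :: (m₁ ++ u₁))
      (r₁ := u₂ ++ (n₂ ++ [s₂, t₂] ++ n₃ ++ [y])) (A := p ++ m₁.flatMap g ++ u₁.flatMap g)
      (G := u₂.flatMap g ++ L) ?_ h1 ?_ ?_ ?_
    · rw [hw', h2]; simp
    · rw [← hL, h2]; simp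
    · simp [← hp]
    · rw [h3]; simp
  · obtain ⟨K, hK⟩ : U <+: p ++ m₁.flatMap g ++ [s₁, t₁].flatMap g ++ n₂.flatMap g := by
      refine List.prefix_of_prefix_length_le (l₃ := U ++ U ++ U) ⟨U ++ U, by simp⟩ ?_ ?_
      · rw [hU3, hw']
        exact ⟨([s₂, t₂] ++ n₃).flatMap g ++ s, by simp⟩
      · simp only [List.length_append] at hc ⊢
        omega
    have hUU : U ++ U = K ++ [s₂, t₂].flatMap g ++ (n₃.flatMap g ++ s) := by
      have : U ++ (U ++ U) = U ++ (K ++ [s₂, t₂].flatMap g ++ (n₃.flatMap g ++ s)) := by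
        rw [← List.append_assoc, hU3, hw', ← List.append_assoc, ← List.append_assoc U, hK]
        simp
      exact List.append_cancel_left this
    obtain ⟨w₁, w₂, u₁, u₂, h1, h2, h3⟩ := exists_common_cut hg hab hle hst₂ hw
      (P := P ++ K) (S := n₃.flatMap g ++ s ++ U ++ S) (by rw [h, hUU]; simp)
    refine false_of_shifted_cut hg hne hw hU h h1 (c₂ := x :: (m₁ ++ [s₁, t₁] ++ n₂ ++ u₁))
      (r₂ := u₂ ++ (n₃ ++ [y])) (A := K ++ u₁.flatMap g)
      (G := u₂.flatMap g ++ (n₃.flatMap g ++ s)) ?_ ?_ ?_ ?_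
    · rw [hw', h2]; simp
    · rw [hUU, h2]; simp
    · rw [h3]; simp
    · have : P ++ U ++ (K ++ u₁.flatMap g) = P ++ (U ++ K) ++ u₁.flatMap g := by simp
      rw [this, hK]
      simp [← hp]

end Morphisms

theorem toList_map_ofList (f : FreeMonoid (Fin 2) →* FreeMonoid (Fin 2)) (w : List (Fin 2)) :
    FreeMonoid.toList (f (FreeMonoid.ofList w)) =
      w.flatMap (fun i => FreeMonoid.toList (f (FreeMonoid.of i))) := by
  induction w with
  | nil => simp
  | cons c w ih => simp [ih]

theorem richomme_wlazinski (f : FreeMonoid (Fin 2) →* FreeMonoid (Fin 2)) :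
    (∀ w : List (Fin 2), CubeFree w → CubeFree (FreeMonoid.toList (f (FreeMonoid.ofList w)))) ↔
    (∀ u : List (Fin 2), u.length = 7 → CubeFree u →
      CubeFree (FreeMonoid.toList (f (FreeMonoid.ofList u)))) := by
  refine ⟨fun h u _ => h u, fun h w hw => ?_⟩
  simp only [toList_map_ofList] at h ⊢
  have hg := preservesShort_of_length_eq h
  generalize (fun i => FreeMonoid.toList (f (FreeMonoid.of i))) = g at hg
  have hempty : ∀ a b : Fin 2, a ≠ b → g a = [] → g b = [] := by
    intro a b hab ha
    have := hg.test (fun a b => [b, b, a, b]) (by decide) hab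
    exact this.eq_nil (l := []) (r := []) (by simp [ha])
  by_cases h0 : g 0 = []
  · have h1 := hempty 0 1 (by decide) h0
    have : w.flatMap g = [] := by
      simp only [List.flatMap_eq_nil_iff]
      intro i _
      rcases eq_of_ne_two (c := i) (a := 0) (b := 1) (by decide) with rfl | rfl <;> assumption
    rw [this]
    exact hg [] (by simp) (by decide)
  · have hne : ∀ i, g i ≠ [] := by
      intro i hi
      rcases eq_or_ne i 0 with rfl | h
      exacts [h0 hi, h0 (hempty i 0 h hi)]
    rcases le_total (g 0).length (g 1).length with hle | hle
    · exact hg.cubeFree_flatMap hne (by decide : (0 : Fin 2) ≠ 1) hle w hw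
    · exact hg.cubeFree_flatMap hne (by decide : (1 : Fin 2) ≠ 0) hle w hw
end
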